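/- arXiv:2508.14506 — 2 statements merged into one kernel-verified Lean document; each statement's English description precedes it below -/
import Mathlib

section
/- For every pair of integers m, n > 0, there is a wait-free algorithm solving consensus among m+n processes using n-writer m-reader auditable registers (together with standard single-writer multi-reader read/write registers). Consequently, the consensus number of the n-writer m-reader auditable register is at least m+n. -/
/-!
# A generic model of wait-free implementations from shared base objects

Processes communicate through atomic *base objects* (given as sequential
state machines).  An implementation assigns to each process and each
high-level operation a deterministic program which, given the sequence of
primitive responses received so far in the current operation, either applies
the next primitive to some base object or returns a high-level response.
Executions are sequences of events (invocations, primitive steps, responses)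
driven by an arbitrary scheduler.  Linearizability is defined with respect to
a deterministic sequential specification, and wait-freedom/step complexity by
bounding the number of steps a process takes within any of its operations.
-/

namespace Shared

/-- A type of atomic base object: a sequential state machine. -/
structure ObjType where
  St : Type
  Op : Type
  Res : Type
  init : St
  δ : St → Op → St × Res

universe u

variable {P HOp HRes : Type} {I : Type} {mem : I → ObjType}

/-- A deterministic program for one high-level operation: given the list of
primitive responses received so far, either the next primitive to apply
(object index and primitive operation), or the high-level response. -/
def Prog (I : Type) (mem : I → ObjType) (HRes : Type) : Type :=
  List (Σ i : I, (mem i).Res) → (Σ i : I, (mem i).Op) ⊕ HRes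

/-- An implementation of a high-level object with operations `HOp` and
responses `HRes`, for processes `P`, from base objects `mem`. -/
structure Impl (P HOp HRes : Type) (I : Type) (mem : I → ObjType) where
  prog : P → HOp → Prog I mem HRes

/-- A configuration: the state of every base object, and for each process the
pending high-level operation together with the log of primitive responses it
has received so far (`none` if the process is idle). -/
structure Cfg (P HOp : Type) (I : Type) (mem : I → ObjType) where
  mst : ∀ i : I, (mem i).St
  pst : P → Option (HOp × List (Σ i : I, (mem i).Res))

/-- Events: invocation of a high-level operation, a primitive step by a
process, or the response of a high-level operation. -/
inductive Ev (P HOp HRes : Type) where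
  | inv (p : P) (op : HOp)
  | step (p : P)
  | ret (p : P) (r : HRes)

def Ev.isStepOf [DecidableEq P] : Ev P HOp HRes → P → Bool
  | .step q, p => decide (q = p)
  | _, _ => false

def initCfg (P HOp : Type) (I : Type) (mem : I → ObjType) : Cfg P HOp I mem :=
  ⟨fun i => (mem i).init, fun _ => none⟩

/-- The transition relation of the system. -/
def EStep [DecidableEq P] [DecidableEq I] (impl : Impl P HOp HRes I mem)
    (c : Cfg P HOp I mem) (e : Ev P HOp HRes) (c' : Cfg P HOp I mem) : Prop :=
  match e with
  | .inv p op =>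
      c.pst p = none ∧
      c' = { c with pst := Function.update c.pst p (some (op, [])) }
  | .step p =>
      ∃ op log i o, c.pst p = some (op, log) ∧
        impl.prog p op log = Sum.inl ⟨i, o⟩ ∧
        c' = ⟨Function.update c.mst i ((mem i).δ (c.mst i) o).1,
              Function.update c.pst p
                (some (op, log ++ [⟨i, ((mem i).δ (c.mst i) o).2⟩]))⟩
  | .ret p r =>
      ∃ op log, c.pst p = some (op, log) ∧
        impl.prog p op log = Sum.inr r ∧
        c' = { c with pst := Function.update c.pst p none }

/-- A finite execution of an implementation. -/
structure Run [DecidableEq P] [DecidableEq I] (impl : Impl P HOp HRes I mem) where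
  len : ℕ
  cfg : ℕ → Cfg P HOp I mem
  ev : ℕ → Ev P HOp HRes
  h0 : cfg 0 = initCfg P HOp I mem
  hstep : ∀ t, t < len → EStep impl (cfg t) (ev t) (cfg (t + 1))

variable [DecidableEq P] [DecidableEq I]

def InvAt {impl : Impl P HOp HRes I mem} (R : Run impl)
    (t : ℕ) (p : P) (o : HOp) : Prop :=
  t < R.len ∧ R.ev t = .inv p o

def RetAt {impl : Impl P HOp HRes I mem} (R : Run impl)
    (t : ℕ) (p : P) (r : HRes) : Prop :=
  t < R.len ∧ R.ev t = .ret p r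

/-- `tret` is the matching response of the operation of `p` invoked at `tinv`. -/
def MatchedRet {impl : Impl P HOp HRes I mem} (R : Run impl)
    (tinv tret : ℕ) (p : P) (r : HRes) : Prop :=
  tinv < tret ∧ RetAt R tret p r ∧
    ∀ u r', tinv < u → u < tret → ¬ RetAt R u p r'

/-- A deterministic sequential specification of a high-level object. -/
structure SeqSpec (P HOp HRes : Type) where
  St : Type
  init : St
  δ : St → P → HOp → St × HRes

/-- The sequential history `L` is legal for the specification, from state `s`. -/
def SeqConsistent (spec : SeqSpec P HOp HRes) :
    spec.St → List (P × HOp × HRes) → Prop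
  | _, [] => True
  | s, (p, o, r) :: rest =>
      (spec.δ s p o).2 = r ∧ SeqConsistent spec (spec.δ s p o).1 rest

/-- Linearizability of a run: there is a legal sequential history `L`
containing every completed operation of the run (with its actual response)
and possibly some pending ones (completed with arbitrary responses), which
preserves the real-time precedence between operations. -/
def IsLin (spec : SeqSpec P HOp HRes) {impl : Impl P HOp HRes I mem}
    (R : Run impl) : Prop :=
  ∃ (L : List (P × HOp × HRes)) (φ : Fin L.length → ℕ),
    SeqConsistent spec spec.init L ∧
    Function.Injective φ ∧
    -- `φ k` is the invocation of the `k`-th operation of `L`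
    (∀ k, InvAt R (φ k) (L.get k).1 (L.get k).2.1) ∧
    -- every completed operation appears in `L`, with its actual response
    (∀ t p o tr r, InvAt R t p o → MatchedRet R t tr p r →
        ∃ k, φ k = t ∧ L.get k = (p, o, r)) ∧
    (∀ k tr r, MatchedRet R (φ k) tr (L.get k).1 r → (L.get k).2.2 = r) ∧
    -- real-time precedence is preserved
    (∀ k k' tr r, MatchedRet R (φ k) tr (L.get k).1 r → tr < φ k' → k < k')

/-- All invocations in the run respect the role/legality constraint. -/
def LegalRun {impl : Impl P HOp HRes I mem} (R : Run impl)
    (legal : P → HOp → Prop) : Prop :=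
  ∀ t p o, InvAt R t p o → legal p o

/-- A process takes at most `C` of its own primitive steps between the
invocation of any of its operations and its (possibly missing) response:
bounded wait-freedom / step complexity `C` per operation. -/
def StepBound {impl : Impl P HOp HRes I mem}
    (R : Run impl) (C : ℕ) : Prop :=
  ∀ t p o, InvAt R t p o →
    ∀ b, b ≤ R.len → (∀ u r, t < u → u < b → ¬ RetAt R u p r) →
      ((Finset.Ioo t b).filter fun u => (R.ev u).isStepOf p).card ≤ C

/-- The implementation only ever issues primitive operations allowed by
`ok` (used to express port/ownership restrictions on base objects). -/
def IssuesOnly (impl : Impl P HOp HRes I mem)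
    (ok : ∀ (p : P) (i : I), (mem i).Op → Prop) : Prop :=
  ∀ R : Run impl, ∀ t p, t < R.len → R.ev t = .step p →
    ∀ op log i o, (R.cfg t).pst p = some (op, log) →
      impl.prog p op log = Sum.inl ⟨i, o⟩ → ok p i o

/-! ### Base object types -/

/-- Primitive operations of a (sliding or plain) read/write register. -/
inductive RegOp (V : Type) where
  | write (v : V)
  | read

/-- A `k`-sliding register over values `V`: stores the sequence of the last
`k` values written to it; a write appends the new value (discarding the
oldest if the sequence already has length `k`), a read returns the current
sequence. -/
def SlidingReg (k : ℕ) (V : Type) : ObjType where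
  St := List V
  Op := RegOp V
  Res := List V
  init := []
  δ := fun s o =>
    match o with
    | .write v => ((s ++ [v]).drop (s.length + 1 - k), [])
    | .read => (s, s)

/-- A standard atomic read/write register over `V` with initial value `v0`. -/
def RWReg (V : Type) (v0 : V) : ObjType where
  St := V
  Op := RegOp V
  Res := Option V
  init := v0
  δ := fun s o =>
    match o with
    | .write v => (v, none)
    | .read => (s, some s)

end Shared

namespace Shared

/-!
## STATEMENT 0: wait-free consensus among `m + n` processes from `n`-writer
`m`-reader auditable registers and single-writer multi-reader registers.

(Consequently, the consensus number of the `n`-writer `m`-reader auditable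
register is at least `m + n`.)
-/

/-- Primitive operations of an `n`-writer `m`-reader auditable register
(as a base object): a read on reader port `i`, a write on writer port `j`,
and an audit. -/
inductive AudOp (m n : ℕ) where
  | read (i : Fin m)
  | write (j : Fin n) (v : ℕ)
  | audit

/-- Primitive responses of an auditable register base object. -/
inductive AudRes (m : ℕ) where
  | val (v : ℕ)
  | ok
  | aset (A : Finset (Fin m × ℕ))

/-- The `n`-writer `m`-reader auditable register, as an atomic base object
with initial value `v0`: its state is the current value together with the
set of (reader port, value) pairs of the reads performed so far; an audit
returns exactly the pairs corresponding to the preceding reads. -/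
def AudReg (m n : ℕ) (v0 : ℕ) : ObjType where
  St := ℕ × Finset (Fin m × ℕ)
  Op := AudOp m n
  Res := AudRes m
  init := (v0, ∅)
  δ := fun s o =>
    match o with
    | .read i => ((s.1, insert (i, s.1) s.2), .val s.1)
    | .write _ v => ((v, s.2), .ok)
    | .audit => (s, .aset s.2)

section Consensus

variable (m n : ℕ)

/-- Port-ownership restrictions: in every auditable register, each reader
port is used by (at most) one fixed process and each writer port by (at most)
one fixed process (auditing is free); each plain register is a single-writer
multi-reader register: it is written by (at most) one fixed process. -/
def portOK {Ia Ir : Type} (v0a : Ia → ℕ) (Vr : Ir → Type) (vr0 : ∀ r, Vr r)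
    (rown : Ia → Fin m → Fin (m + n)) (wown : Ia → Fin n → Fin (m + n))
    (regown : Ir → Fin (m + n)) :
    ∀ (p : Fin (m + n)) (i : Ia ⊕ Ir),
      ((Sum.elim (fun a : Ia => AudReg m n (v0a a))
                 (fun r : Ir => RWReg (Vr r) (vr0 r))) i).Op → Prop :=
  fun p i => match i with
  | .inl a => fun o =>
      match o with
      | .read ri => p = rown a ri
      | .write wj _ => p = wown a wj
      | .audit => True
  | .inr r => fun o =>
      match o with
      | .write _ => p = regown r
      | .read => True

variable {m n}

/-- In the run, every process invokes (propose) at most once. -/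
def OneShot {P HOp HRes : Type} [DecidableEq P] {I : Type} [DecidableEq I]
    {mem : I → ObjType} {impl : Impl P HOp HRes I mem} (R : Run impl) : Prop :=
  ∀ t t' p o o', InvAt R t p o → InvAt R t' p o' → t = t'

/-- Agreement: all decided values are equal. -/
def Agreement {P HOp HRes : Type} [DecidableEq P] {I : Type} [DecidableEq I]
    {mem : I → ObjType} {impl : Impl P HOp HRes I mem} (R : Run impl) : Prop :=
  ∀ t t' p q v v', RetAt R t p v → RetAt R t' q v' → v = v'

/-- Validity: every decided value was proposed by some process. -/
def Validity {P HRes : Type} [DecidableEq P] {I : Type} [DecidableEq I]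
    {mem : I → ObjType} {impl : Impl P HRes HRes I mem} (R : Run impl) : Prop :=
  ∀ t p v, RetAt R t p v → ∃ t' q, InvAt R t' q v

end Consensus

namespace Aud

/-- Local history of a process: step counter, entry value of every stage, the value
obtained from the auditable register and the chosen target process at every stage. -/
structure Loc (N : ℕ) where
  c : ℕ
  val : ℕ → ℕ
  x : ℕ → ℕ
  tgt : ℕ → Fin N

def Loc.start {N : ℕ} (p : Fin N) (v : ℕ) : Loc N := ⟨0, fun _ => v, fun _ => 0, fun _ => p⟩

/-- Abstract global state. -/
structure AS (m N : ℕ) where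
  R : ℕ × Fin N → ℕ
  X : ℕ → ℕ
  A : ℕ → Finset (Fin m × ℕ)
  loc : Fin N → Option (Loc N)

section
variable {m n N : ℕ} (rown : ℕ → Fin m → Fin N) (wown : ℕ → Fin n → Fin N)

def IsA (s : ℕ) (p : Fin N) : Prop := ∃ i, rown s i = p
def IsB (s : ℕ) (p : Fin N) : Prop := ∃ j, wown s j = p

/-- Some reader has read the initial value. -/
def Zr (A : Finset (Fin m × ℕ)) : Prop := ∃ i, (i, 0) ∈ A

inductive AStep (V : Set ℕ) (σ : AS m N) : AS m N → Prop
  | start (p : Fin N) (v : ℕ) (h : σ.loc p = none) (hv : v ∈ V) :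
      AStep V σ { σ with loc := Function.update σ.loc p (some (Loc.start p v)) }
  | ann (p : Fin N) (l : Loc N) (s : ℕ) (h : σ.loc p = some l) (hc : l.c = 4 * s) :
      AStep V σ { σ with
        R := Function.update σ.R (s, p) (l.val s)
        loc := Function.update σ.loc p (some { l with c := l.c + 1 }) }
  | rd (p : Fin N) (l : Loc N) (s : ℕ) (i : Fin m) (h : σ.loc p = some l)
      (hc : l.c = 4 * s + 1) (hi : rown s i = p) :
      AStep V σ { σ with
        A := Function.update σ.A s (insert (i, σ.X s) (σ.A s))
        loc := Function.update σ.loc p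
          (some { l with c := l.c + 1, x := Function.update l.x s (σ.X s) }) }
  | wr (p : Fin N) (l : Loc N) (s : ℕ) (h : σ.loc p = some l)
      (hc : l.c = 4 * s + 1) (hB : IsB wown s p) :
      AStep V σ { σ with
        X := Function.update σ.X s (p.val + 1)
        loc := Function.update σ.loc p
          (some { l with c := l.c + 1, x := Function.update l.x s (p.val + 1) }) }
  | idle (p : Fin N) (l : Loc N) (s : ℕ) (y : ℕ) (h : σ.loc p = some l)
      (hc : l.c = 4 * s + 1) (hA : ¬ IsA rown s p) (hB : ¬ IsB wown s p) :
      AStep V σ { σ with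
        loc := Function.update σ.loc p
          (some { l with c := l.c + 1, x := Function.update l.x s y }) }
  | aud (p : Fin N) (l : Loc N) (s : ℕ) (T : Fin N) (h : σ.loc p = some l)
      (hc : l.c = 4 * s + 2)
      (h1 : (IsA rown s p ∨ IsB wown s p) → Zr (σ.A s) → ∃ i, (i, 0) ∈ σ.A s ∧ rown s i = T)
      (h2 : (IsA rown s p ∨ IsB wown s p) → ¬ Zr (σ.A s) → ∀ q : Fin N, q.val + 1 = l.x s → T = q)
      (h3 : ¬ (IsA rown s p ∨ IsB wown s p) → T = p) :
      AStep V σ { σ with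
        loc := Function.update σ.loc p
          (some { l with c := l.c + 1, tgt := Function.update l.tgt s T }) }
  | fin (p : Fin N) (l : Loc N) (s : ℕ) (h : σ.loc p = some l)
      (hc : l.c = 4 * s + 3) :
      AStep V σ { σ with
        loc := Function.update σ.loc p
          (some { l with c := l.c + 1,
                         val := Function.update l.val (s + 1) (σ.R (s, l.tgt s)) }) }

/-- `q` has announced at stage `s` the value `w`. -/
def Ann (σ : AS m N) (s : ℕ) (q : Fin N) : Prop := ∃ l, σ.loc q = some l ∧ 4 * s < l.c

structure Inv (V : Set ℕ) (σ : AS m N) : Prop where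
  i0 : ∀ p l, σ.loc p = some l → l.val 0 ∈ V
  i1 : ∀ p l s, σ.loc p = some l → 4 * s < l.c → σ.R (s, p) = l.val s
  i2 : ∀ s i, (i, 0) ∈ σ.A s → Ann σ s (rown s i)
  i3 : ∀ s, σ.X s ≠ 0 → ∃ q : Fin N, q.val + 1 = σ.X s ∧ IsB wown s q ∧ Ann σ s q
  i4 : ∀ p l s, σ.loc p = some l → 4 * s + 2 ≤ l.c → (IsA rown s p ∨ IsB wown s p) →
    l.x s = 0 → Zr (σ.A s)
  i4' : ∀ p l s, σ.loc p = some l → 4 * s + 2 ≤ l.c → (IsA rown s p ∨ IsB wown s p) →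
    l.x s ≠ 0 → σ.X s ≠ 0 ∧ ∃ q : Fin N, q.val + 1 = l.x s ∧ IsB wown s q ∧ Ann σ s q
  i5 : ∀ p l s, σ.loc p = some l → 4 * s + 3 ≤ l.c → (IsA rown s p ∨ IsB wown s p) →
    Ann σ s (l.tgt s) ∧ ((Zr (σ.A s) ∧ IsA rown s (l.tgt s)) ∨
      (¬ Zr (σ.A s) ∧ σ.X s ≠ 0 ∧ IsB wown s (l.tgt s)))
  i5' : ∀ p l s, σ.loc p = some l → 4 * s + 3 ≤ l.c → ¬ (IsA rown s p ∨ IsB wown s p) →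
    l.tgt s = p
  i6 : ∀ p l s, σ.loc p = some l → 4 * s + 4 ≤ l.c → l.val (s + 1) = σ.R (s, l.tgt s)


structure Frame (V : Set ℕ) (σ σ' : AS m N) : Prop where
  ann : ∀ s q, Ann σ s q → Ann σ' s q
  z : ∀ s, Zr (σ.A s) → Zr (σ'.A s)
  x : ∀ s, σ.X s ≠ 0 → σ'.X s ≠ 0
  zst : ∀ s, σ.X s ≠ 0 → Zr (σ'.A s) → Zr (σ.A s)
  r : ∀ s q, Ann σ s q → σ'.R (s, q) = σ.R (s, q)
  l : ∀ q l', σ'.loc q = some l' → (l'.c = 0 ∧ l'.val 0 ∈ V) ∨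
    ∃ l, σ.loc q = some l ∧ (l'.c = l.c ∨ l'.c = l.c + 1) ∧ (∀ s, 4 * s ≤ l.c → l'.val s = l.val s) ∧
      (∀ s, 4 * s + 2 ≤ l.c → l'.x s = l.x s) ∧ (∀ s, 4 * s + 3 ≤ l.c → l'.tgt s = l.tgt s)

theorem locFrame (V : Set ℕ) (σ : AS m N) (p : Fin N) (l k : Loc N) (h : σ.loc p = some l)
    (hc : k.c = l.c + 1) (hv : ∀ s, 4 * s ≤ l.c → k.val s = l.val s)
    (hx : ∀ s, 4 * s + 2 ≤ l.c → k.x s = l.x s)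
    (ht : ∀ s, 4 * s + 3 ≤ l.c → k.tgt s = l.tgt s) (q : Fin N) (l' : Loc N)
    (hq : Function.update σ.loc p (some k) q = some l') : (l'.c = 0 ∧ l'.val 0 ∈ V) ∨
    ∃ l, σ.loc q = some l ∧ (l'.c = l.c ∨ l'.c = l.c + 1) ∧ (∀ s, 4 * s ≤ l.c → l'.val s = l.val s) ∧
      (∀ s, 4 * s + 2 ≤ l.c → l'.x s = l.x s) ∧ (∀ s, 4 * s + 3 ≤ l.c → l'.tgt s = l.tgt s) := by
  right
  by_cases e : q = p
  · subst e
    simp at hq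
    subst hq
    exact ⟨l, h, Or.inr hc, hv, hx, ht⟩
  · rw [Function.update_of_ne e] at hq
    exact ⟨l', hq, Or.inl rfl, fun _ _ => rfl, fun _ _ => rfl, fun _ _ => rfl⟩

theorem annFrame (σ : AS m N) (p : Fin N) (l k : Loc N) (h : σ.loc p = some l)
    (hc : k.c = l.c + 1) (s : ℕ) (q : Fin N) (hq : ∃ l, σ.loc q = some l ∧ 4 * s < l.c) :
    ∃ l, Function.update σ.loc p (some k) q = some l ∧ 4 * s < l.c := by
  obtain ⟨l0, h0, h1⟩ := hq
  by_cases e : q = p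
  · subst e
    refine ⟨k, by simp, ?_⟩
    rw [h] at h0
    cases h0
    omega
  · exact ⟨l0, by rw [Function.update_of_ne e]; exact h0, h1⟩

theorem frame {V : Set ℕ} {σ σ' : AS m N} (h : AStep rown wown V σ σ') : Frame V σ σ' := by
  cases h with
  | start p v h hv =>
    refine ⟨?_, fun _ h => h, fun _ h => h, fun _ _ h => h, fun _ _ _ => rfl, ?_⟩
    · rintro s q ⟨l, hl, hc⟩
      refine ⟨l, ?_, hc⟩
      have : q ≠ p := by rintro rfl; simp [h] at hl
      simpa [Function.update_of_ne this] using hl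
    · intro q l' hq
      by_cases e : q = p
      · subst e
        simp at hq
        subst hq
        exact Or.inl ⟨rfl, hv⟩
      · simp only [Function.update_of_ne e] at hq
        exact Or.inr ⟨l', hq, Or.inl rfl, fun _ _ => rfl, fun _ _ => rfl, fun _ _ => rfl⟩
  | ann p l s h hc =>
    refine ⟨annFrame σ p l _ h rfl, fun _ h => h, fun _ h => h, fun _ _ h => h, ?_,
      locFrame V σ p l _ h rfl (fun _ _ => rfl) (fun _ _ => rfl) (fun _ _ => rfl)⟩
    rintro t q ⟨l0, h0, h1⟩
    apply Function.update_of_ne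
    rintro ⟨⟩
    rw [h] at h0
    cases h0
    omega
  | rd p l s i h hc hi =>
    refine ⟨annFrame σ p l _ h rfl, ?_, fun _ h => h, ?_, fun _ _ _ => rfl,
      locFrame V σ p l _ h rfl (fun _ _ => rfl) ?_ (fun _ _ => rfl)⟩
    · rintro t ⟨j, hj⟩
      refine ⟨j, ?_⟩
      by_cases e : t = s
      · subst e; simp [hj]
      · simp [Function.update_of_ne e, hj]
    · rintro t hx ⟨j, hj⟩
      refine ⟨j, ?_⟩
      by_cases e : t = s
      · subst e
        simp at hj
        rcases hj with hj | hj
        · exact absurd hj.2.symm hx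
        · exact hj
      · simpa [Function.update_of_ne e] using hj
    · intro t ht
      apply Function.update_of_ne
      omega
  | wr p l s h hc hB =>
    refine ⟨annFrame σ p l _ h rfl, fun _ h => h, ?_, fun _ _ h => h, fun _ _ _ => rfl,
      locFrame V σ p l _ h rfl (fun _ _ => rfl) ?_ (fun _ _ => rfl)⟩
    · intro t ht
      by_cases e : t = s
      · subst e; simp
      · simpa [Function.update_of_ne e] using ht
    · intro t ht
      apply Function.update_of_ne
      omega
  | idle p l s y h hc hA hB =>
    refine ⟨annFrame σ p l _ h rfl, fun _ h => h, fun _ h => h, fun _ _ h => h, fun _ _ _ => rfl,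
      locFrame V σ p l _ h rfl (fun _ _ => rfl) ?_ (fun _ _ => rfl)⟩
    · intro t ht
      apply Function.update_of_ne
      omega
  | aud p l s T h hc h1 h2 h3 =>
    refine ⟨annFrame σ p l _ h rfl, fun _ h => h, fun _ h => h, fun _ _ h => h, fun _ _ _ => rfl,
      locFrame V σ p l _ h rfl (fun _ _ => rfl) (fun _ _ => rfl) ?_⟩
    · intro t ht
      apply Function.update_of_ne
      omega
  | fin p l s h hc =>
    refine ⟨annFrame σ p l _ h rfl, fun _ h => h, fun _ h => h, fun _ _ h => h, fun _ _ _ => rfl,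
      locFrame V σ p l _ h rfl ?_ (fun _ _ => rfl) (fun _ _ => rfl)⟩
    · intro t ht
      apply Function.update_of_ne
      omega

/-- What happens when a counter is really incremented. -/
theorem locStep {V : Set ℕ} {σ σ' : AS m N} (h : AStep rown wown V σ σ') {q : Fin N} {l l' : Loc N}
    (hl : σ.loc q = some l) (hl' : σ'.loc q = some l') (hc : l'.c = l.c + 1) :
    (∀ s, l.c = 4 * s → σ'.R (s, q) = l.val s) ∧
    (∀ s, l.c = 4 * s + 1 → (IsA rown s q ∨ IsB wown s q) →
      (l'.x s = σ.X s ∧ ∃ i, rown s i = q ∧ (i, σ.X s) ∈ σ'.A s) ∨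
      (IsB wown s q ∧ l'.x s = q.val + 1 ∧ σ'.X s ≠ 0)) ∧
    (∀ s, l.c = 4 * s + 2 → σ'.A s = σ.A s ∧ σ'.X s = σ.X s ∧
      ((IsA rown s q ∨ IsB wown s q) → Zr (σ.A s) → ∃ i, (i, 0) ∈ σ.A s ∧ rown s i = l'.tgt s) ∧
      ((IsA rown s q ∨ IsB wown s q) → ¬ Zr (σ.A s) →
        ∀ r : Fin N, r.val + 1 = l.x s → l'.tgt s = r) ∧
      (¬ (IsA rown s q ∨ IsB wown s q) → l'.tgt s = q)) ∧
    (∀ s, l.c = 4 * s + 3 → l'.val (s + 1) = σ.R (s, l.tgt s)) := by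
  have key : ∀ (p : Fin N) (k l0 : Loc N), σ.loc p = some l0 →
      Function.update σ.loc p (some k) q = some l' → q = p ∧ l' = k ∧ l0 = l := by
    intro p k l0 h0 h1
    by_cases e : q = p
    · subst e
      simp at h1
      rw [hl] at h0
      cases h0
      exact ⟨rfl, h1.symm, rfl⟩
    · rw [Function.update_of_ne e, hl] at h1
      cases h1
      omega
  cases h with
  | start p v h hv =>
    exfalso
    have e : q ≠ p := by rintro rfl; simp [h] at hl
    simp only [Function.update_of_ne e] at hl'
    rw [hl] at hl'
    cases hl'
    omega
  | ann p l s h hc =>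
    obtain ⟨rfl, rfl, rfl⟩ := key _ _ _ h hl'
    refine ⟨?_, ?_, ?_, ?_⟩ <;> intro t ht <;> try omega
    obtain rfl : t = s := by omega
    simp
  | rd p l s i h hc hi =>
    obtain ⟨rfl, rfl, rfl⟩ := key _ _ _ h hl'
    refine ⟨?_, ?_, ?_, ?_⟩ <;> intro t ht <;> try omega
    obtain rfl : t = s := by omega
    intro _
    left
    exact ⟨by simp, i, hi, by simp⟩
  | wr p l s h hc hB =>
    obtain ⟨rfl, rfl, rfl⟩ := key _ _ _ h hl'
    refine ⟨?_, ?_, ?_, ?_⟩ <;> intro t ht <;> try omega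
    obtain rfl : t = s := by omega
    intro _
    right
    exact ⟨hB, by simp, by simp⟩
  | idle p l s y h hc hA hB =>
    obtain ⟨rfl, rfl, rfl⟩ := key _ _ _ h hl'
    refine ⟨?_, ?_, ?_, ?_⟩ <;> intro t ht <;> try omega
    obtain rfl : t = s := by omega
    intro h
    exact absurd h (by tauto)
  | aud p l s T h hc h1 h2 h3 =>
    obtain ⟨rfl, rfl, rfl⟩ := key _ _ _ h hl'
    refine ⟨?_, ?_, ?_, ?_⟩ <;> intro t ht <;> try omega
    obtain rfl : t = s := by omega
    simp only [Function.update_self]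
    exact ⟨trivial, trivial, h1, h2, h3⟩
  | fin p l s h hc =>
    obtain ⟨rfl, rfl, rfl⟩ := key _ _ _ h hl'
    refine ⟨?_, ?_, ?_, ?_⟩ <;> intro t ht <;> try omega
    obtain rfl : t = s := by omega
    simp

theorem memStep {V : Set ℕ} {σ σ' : AS m N} (h : AStep rown wown V σ σ') :
    (∀ s i, (i, 0) ∈ σ'.A s → (i, 0) ∈ σ.A s ∨ Ann σ s (rown s i)) ∧
    (∀ s, σ'.X s = σ.X s ∨ ∃ q : Fin N, q.val + 1 = σ'.X s ∧ IsB wown s q ∧ Ann σ s q) := by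
  cases h with
  | rd p l s i h hc hi =>
    refine ⟨?_, fun _ => Or.inl rfl⟩
    intro t j hj
    by_cases e : t = s
    · subst e
      simp at hj
      rcases hj with hj | hj
      · right
        rw [hj.1, hi]
        exact ⟨l, h, by omega⟩
      · exact Or.inl hj
    · simp [Function.update_of_ne e] at hj
      exact Or.inl hj
  | wr p l s h hc hB =>
    refine ⟨fun _ _ h => Or.inl h, ?_⟩
    intro t
    by_cases e : t = s
    · subst e
      exact Or.inr ⟨p, by simp, hB, l, h, by omega⟩
    · left
      simp [Function.update_of_ne e]
  | _ => exact ⟨fun _ _ h => Or.inl h, fun _ => Or.inl rfl⟩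

theorem inv_step {V : Set ℕ} {σ σ' : AS m N} (h : AStep rown wown V σ σ')
    (I : Inv rown wown V σ) : Inv rown wown V σ' := by
  have F := frame rown wown h
  have M := memStep rown wown h
  have i3' : ∀ s, σ'.X s ≠ 0 → ∃ q : Fin N, q.val + 1 = σ'.X s ∧ IsB wown s q ∧ Ann σ' s q := by
    intro s hs
    rcases M.2 s with e | ⟨q, h1, h2, h3⟩
    · rw [e] at hs ⊢
      obtain ⟨q, h1, h2, h3⟩ := I.i3 s hs
      exact ⟨q, h1, h2, F.ann _ _ h3⟩
    · exact ⟨q, h1, h2, F.ann _ _ h3⟩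
  refine ⟨?_, ?_, ?_, i3', ?_, ?_, ?_, ?_, ?_⟩
  · intro p l' hl'
    rcases F.l p l' hl' with ⟨_, h0⟩ | ⟨l, hl, hc, hv, hx, ht⟩
    · exact h0
    · rw [hv 0 (by omega)]
      exact I.i0 p l hl
  · intro p l' s hl' hs
    rcases F.l p l' hl' with ⟨_, h0⟩ | ⟨l, hl, hc, hv, hx, ht⟩
    · omega
    · by_cases hb : 4 * s < l.c
      · rw [F.r _ _ ⟨l, hl, hb⟩, I.i1 p l s hl hb, hv s (by omega)]
      · rw [(locStep rown wown h hl hl' (by omega)).1 s (by omega), hv s (by omega)]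
  · intro s i hi
    rcases M.1 s i hi with h1 | h1
    · exact F.ann _ _ (I.i2 _ _ h1)
    · exact F.ann _ _ h1
  · intro p l' s hl' hs hp h0
    rcases F.l p l' hl' with ⟨_, _⟩ | ⟨l, hl, hc, hv, hx, ht⟩
    · omega
    · by_cases hb : 4 * s + 2 ≤ l.c
      · rw [hx s hb] at h0
        exact F.z _ (I.i4 p l s hl hb hp h0)
      · rcases (locStep rown wown h hl hl' (by omega)).2.1 s (by omega) hp with
          ⟨h1, i, h2, h3⟩ | ⟨h1, h2, h3⟩
        · rw [← h1, h0] at h3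
          exact ⟨i, h3⟩
        · omega
  · intro p l' s hl' hs hp h0
    rcases F.l p l' hl' with ⟨_, _⟩ | ⟨l, hl, hc, hv, hx, ht⟩
    · omega
    · by_cases hb : 4 * s + 2 ≤ l.c
      · rw [hx s hb] at h0 ⊢
        obtain ⟨h1, q, h2, h3, h4⟩ := I.i4' p l s hl hb hp h0
        exact ⟨F.x _ h1, q, h2, h3, F.ann _ _ h4⟩
      · rcases (locStep rown wown h hl hl' (by omega)).2.1 s (by omega) hp with
          ⟨h1, i, h2, h3⟩ | ⟨h1, h2, h3⟩
        · rw [h1] at h0 ⊢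
          obtain ⟨q, h4, h5, h6⟩ := I.i3 s h0
          exact ⟨F.x _ h0, q, h4, h5, F.ann _ _ h6⟩
        · exact ⟨h3, p, h2.symm, h1, l', hl', by omega⟩
  · intro p l' s hl' hs hp
    rcases F.l p l' hl' with ⟨_, _⟩ | ⟨l, hl, hc, hv, hx, ht⟩
    · omega
    · by_cases hb : 4 * s + 3 ≤ l.c
      · rw [ht s hb]
        obtain ⟨h1, h2⟩ := I.i5 p l s hl hb hp
        refine ⟨F.ann _ _ h1, ?_⟩
        rcases h2 with ⟨h2, h3⟩ | ⟨h2, h3, h4⟩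
        · exact Or.inl ⟨F.z _ h2, h3⟩
        · exact Or.inr ⟨fun hz => h2 (F.zst _ h3 hz), F.x _ h3, h4⟩
      · obtain ⟨hA, hX, h1, h2, -⟩ :=
          (locStep rown wown h hl hl' (by omega)).2.2.1 s (by omega)
        rw [hA, hX]
        by_cases hz : Zr (σ.A s)
        · obtain ⟨i, hi, hiT⟩ := h1 hp hz
          rw [← hiT]
          exact ⟨F.ann _ _ (I.i2 _ _ hi), Or.inl ⟨hz, i, rfl⟩⟩
        · have hx0 : l.x s ≠ 0 := fun h0 => hz (I.i4 p l s hl (by omega) hp h0)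
          obtain ⟨h3, q, h4, h5, h6⟩ := I.i4' p l s hl (by omega) hp hx0
          rw [h2 hp hz q h4]
          exact ⟨F.ann _ _ h6, Or.inr ⟨hz, h3, h5⟩⟩
  · intro p l' s hl' hs hp
    rcases F.l p l' hl' with ⟨_, _⟩ | ⟨l, hl, hc, hv, hx, ht⟩
    · omega
    · by_cases hb : 4 * s + 3 ≤ l.c
      · rw [ht s hb]
        exact I.i5' p l s hl hb hp
      · exact ((locStep rown wown h hl hl' (by omega)).2.2.1 s (by omega)).2.2.2.2 hp
  · intro p l' s hl' hs
    rcases F.l p l' hl' with ⟨_, _⟩ | ⟨l, hl, hc, hv, hx, ht⟩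
    · omega
    · have hann : Ann σ s (l.tgt s) := by
        by_cases hp : IsA rown s p ∨ IsB wown s p
        · exact (I.i5 p l s hl (by omega) hp).1
        · rw [I.i5' p l s hl (by omega) hp]
          exact ⟨l, hl, by omega⟩
      rw [ht s (by omega), F.r _ _ hann]
      by_cases hb : 4 * s + 4 ≤ l.c
      · rw [hv (s + 1) (by omega)]
        exact I.i6 p l s hl hb
      · exact (locStep rown wown h hl hl' (by omega)).2.2.2 s (by omega)

/-- The value with which a process enters stage `s+1` is that with which its target entered `s`. -/
theorem inv_target {V : Set ℕ} {σ : AS m N} (I : Inv rown wown V σ) {p : Fin N} {l : Loc N} {s : ℕ}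
    (hl : σ.loc p = some l) (hs : 4 * s + 4 ≤ l.c) :
    ∃ k, σ.loc (l.tgt s) = some k ∧ 4 * s < k.c ∧ l.val (s + 1) = k.val s := by
  have hann : Ann σ s (l.tgt s) := by
    by_cases hp : IsA rown s p ∨ IsB wown s p
    · exact (I.i5 p l s hl (by omega) hp).1
    · rw [I.i5' p l s hl (by omega) hp]
      exact ⟨l, hl, by omega⟩
  obtain ⟨k, hk, hc⟩ := hann
  exact ⟨k, hk, hc, by rw [I.i6 p l s hl hs, I.i1 _ k s hk hc]⟩

theorem inv_valid {V : Set ℕ} {σ : AS m N} (I : Inv rown wown V σ) (s : ℕ) :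
    ∀ (p : Fin N) (l : Loc N), σ.loc p = some l → 4 * s ≤ l.c → l.val s ∈ V := by
  induction s with
  | zero => intro p l hl _; exact I.i0 p l hl
  | succ s ih =>
    intro p l hl hs
    obtain ⟨k, hk, hc, e⟩ := inv_target rown wown I hl (by omega : 4 * s + 4 ≤ l.c)
    rw [e]
    exact ih _ k hk (by omega)

/-- The labels describe groups of processes which agree at the beginning of every stage. -/
structure Lab (K : ℕ) (lab : ℕ → Fin N → ℕ) : Prop where
  inj : ∀ p q, lab 0 p = lab 0 q → p = q
  a : ∀ s < K, ∀ p q, IsA rown s p → IsA rown s q → lab s p = lab s q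
  b : ∀ s < K, ∀ p q, IsB wown s p → IsB wown s q → lab s p = lab s q
  next : ∀ s < K, ∀ p q, lab (s + 1) p = lab (s + 1) q →
    ((IsA rown s p ∨ IsB wown s p) ∧ (IsA rown s q ∨ IsB wown s q)) ∨
    (¬ (IsA rown s p ∨ IsB wown s p) ∧ ¬ (IsA rown s q ∨ IsB wown s q) ∧ lab s p = lab s q)

theorem inv_agree {V : Set ℕ} {σ : AS m N} (I : Inv rown wown V σ) {K : ℕ} {lab : ℕ → Fin N → ℕ}
    (H : Lab rown wown K lab) (s : ℕ) (hs : s ≤ K) :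
    ∀ (p q : Fin N) (l k : Loc N), σ.loc p = some l → σ.loc q = some k → 4 * s ≤ l.c → 4 * s ≤ k.c →
      lab s p = lab s q → l.val s = k.val s := by
  induction s with
  | zero =>
    intro p q l k hl hk _ _ e
    obtain rfl := H.inj p q e
    rw [hl] at hk
    cases hk
    rfl
  | succ s ih =>
    intro p q l k hl hk hlc hkc e
    obtain ⟨l1, hl1, hc1, e1⟩ := inv_target rown wown I hl (by omega : 4 * s + 4 ≤ l.c)
    obtain ⟨l2, hl2, hc2, e2⟩ := inv_target rown wown I hk (by omega : 4 * s + 4 ≤ k.c)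
    rw [e1, e2]
    refine ih (by omega) _ _ l1 l2 hl1 hl2 (by omega) (by omega) ?_
    rcases H.next s (by omega) p q e with ⟨hp, hq⟩ | ⟨hp, hq, e⟩
    · have h1 := (I.i5 p l s hl (by omega) hp).2
      have h2 := (I.i5 q k s hk (by omega) hq).2
      rcases h1 with ⟨z1, h1⟩ | ⟨z1, _, h1⟩ <;> rcases h2 with ⟨z2, h2⟩ | ⟨z2, _, h2⟩
      · exact H.a s (by omega) _ _ h1 h2
      · exact absurd z1 z2
      · exact absurd z2 z1
      · exact H.b s (by omega) _ _ h1 h2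
    · rw [I.i5' p l s hl (by omega) hp, I.i5' q k s hk (by omega) hq]
      exact e

end

end Aud

namespace Aud

section Schedule
variable (m n : ℕ)

def rownF (s : ℕ) (i : Fin m) : Fin (m + n) :=
  if h : s + 1 < m then ⟨min i.val s, by omega⟩
  else if h : s + 2 < m + n then ⟨s + 2, h⟩
  else ⟨i.val, by omega⟩

def wownF (s : ℕ) (j : Fin n) : Fin (m + n) :=
  if h : s + 1 < m then ⟨s + 1, by omega⟩
  else if h : s + 2 < m + n then ⟨m + min j.val (s + 1 - m), by omega⟩
  else ⟨m + j.val, by omega⟩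

def labF (s : ℕ) (p : Fin (m + n)) : ℕ :=
  if s + 1 < m + n then
    (if p.val < m then (if p.val ≤ s then 0 else p.val)
      else (if p.val ≤ s + 1 then m else p.val))
  else 0

theorem isA_iff (hm : 0 < m) (s : ℕ) (p : Fin (m + n)) : IsA (rownF m n) s p ↔
    (if s + 1 < m then p.val ≤ s else if s + 2 < m + n then p.val = s + 2 else p.val < m) := by
  unfold IsA rownF
  split_ifs with h1 h2
  · constructor
    · rintro ⟨i, rfl⟩; simp
    · intro h
      exact ⟨⟨p.val, by omega⟩, Fin.ext (by simpa using h)⟩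
  · constructor
    · rintro ⟨i, rfl⟩; simp
    · intro h
      exact ⟨⟨0, hm⟩, Fin.ext h.symm⟩
  · constructor
    · rintro ⟨i, rfl⟩; simp
    · intro h
      exact ⟨⟨p.val, h⟩, rfl⟩

theorem isB_iff (hn : 0 < n) (s : ℕ) (p : Fin (m + n)) : IsB (wownF m n) s p ↔
    (if s + 1 < m then p.val = s + 1 else if s + 2 < m + n then m ≤ p.val ∧ p.val ≤ s + 1
      else m ≤ p.val) := by
  unfold IsB wownF
  split_ifs with h1 h2
  · constructor
    · rintro ⟨i, rfl⟩; simp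
    · intro h
      exact ⟨⟨0, hn⟩, Fin.ext h.symm⟩
  · constructor
    · rintro ⟨i, rfl⟩
      simp only
      omega
    · intro h
      refine ⟨⟨p.val - m, by omega⟩, Fin.ext ?_⟩
      simp only
      omega
  · constructor
    · rintro ⟨i, rfl⟩; simp
    · intro h
      refine ⟨⟨p.val - m, by omega⟩, Fin.ext ?_⟩
      simp only
      omega

theorem lab_ok (hm : 0 < m) (hn : 0 < n) :
    Lab (rownF m n) (wownF m n) (m + n - 1) (labF m n) := by
  refine ⟨?_, ?_, ?_, ?_⟩
  · intro p q h
    apply Fin.ext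
    unfold labF at h
    split_ifs at h <;> omega
  · intro s hs p q
    rw [isA_iff m n hm, isA_iff m n hm]
    unfold labF
    split_ifs <;> omega
  · intro s hs p q
    rw [isB_iff m n hn, isB_iff m n hn]
    unfold labF
    split_ifs <;> omega
  · intro s hs p q
    rw [isA_iff m n hm, isA_iff m n hm, isB_iff m n hn, isB_iff m n hn]
    unfold labF
    have := p.isLt
    have := q.isLt
    by_cases h1 : s + 1 < m
    · simp only [h1, if_true]
      split_ifs <;> omega
    · by_cases h2 : s + 2 < m + n
      · simp only [h1, h2, if_true, if_false]
        split_ifs <;> omega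
      · simp only [h1, h2, if_false]
        omega

end Schedule

section Concrete
variable {m n : ℕ}

abbrev Mem (m n : ℕ) : ℕ ⊕ (ℕ × Fin (m + n)) → ObjType :=
  Sum.elim (fun _ : ℕ => AudReg m n 0) (fun _ : ℕ × Fin (m + n) => RWReg ℕ 0)

abbrev Resp (m n : ℕ) : Type := Σ i, (Mem m n i).Res

def getX (d : ℕ) : Resp m n → ℕ
  | ⟨.inl _, r⟩ => match (r : AudRes m) with
    | .val y => y
    | _ => d
  | ⟨.inr _, _⟩ => d

def getA : Resp m n → Finset (Fin m × ℕ)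
  | ⟨.inl _, r⟩ => match (r : AudRes m) with
    | .aset A => A
    | _ => ∅
  | ⟨.inr _, _⟩ => ∅

def getV : Resp m n → ℕ
  | ⟨.inl _, _⟩ => 0
  | ⟨.inr _, r⟩ => match (r : Option ℕ) with
    | some y => y
    | none => 0

open Classical in
noncomputable def pick (p : Fin (m + n)) (s x : ℕ) (A : Finset (Fin m × ℕ)) : Fin (m + n) :=
  if IsA (rownF m n) s p ∨ IsB (wownF m n) s p then
    if h : Zr A then rownF m n s h.choose
    else if h : ∃ q : Fin (m + n), q.val + 1 = x then h.choose else p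
  else p

noncomputable def upd (p : Fin (m + n)) (l : Loc (m + n)) (r : Resp m n) : Loc (m + n) :=
  if l.c % 4 = 0 then { l with c := l.c + 1 }
  else if l.c % 4 = 1 then
    { l with c := l.c + 1, x := Function.update l.x (l.c / 4) (getX (p.val + 1) r) }
  else if l.c % 4 = 2 then
    { l with c := l.c + 1,
             tgt := Function.update l.tgt (l.c / 4) (pick p (l.c / 4) (l.x (l.c / 4)) (getA r)) }
  else { l with c := l.c + 1, val := Function.update l.val (l.c / 4 + 1) (getV r) }

theorem upd_c (p : Fin (m + n)) (l : Loc (m + n)) (r : Resp m n) : (upd p l r).c = l.c + 1 := by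
  unfold upd
  split_ifs <;> rfl

abbrev mkA (s : ℕ) (o : AudOp m n) : Σ i, (Mem m n i).Op := ⟨.inl s, o⟩
abbrev mkR (s : ℕ × Fin (m + n)) (o : RegOp ℕ) : Σ i, (Mem m n i).Op := ⟨.inr s, o⟩

open Classical in
noncomputable def nextOp (p : Fin (m + n)) (l : Loc (m + n)) : Σ i, (Mem m n i).Op :=
  if l.c % 4 = 0 then mkR (l.c / 4, p) (.write (l.val (l.c / 4)))
  else if l.c % 4 = 1 then
    if h : IsA (rownF m n) (l.c / 4) p then mkA (l.c / 4) (.read h.choose)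
    else if h : IsB (wownF m n) (l.c / 4) p then mkA (l.c / 4) (.write h.choose (p.val + 1))
    else mkA (l.c / 4) .audit
  else if l.c % 4 = 2 then mkA (l.c / 4) .audit
  else mkR (l.c / 4, l.tgt (l.c / 4)) .read

noncomputable def fold (p : Fin (m + n)) (op : ℕ) (log : List (Resp m n)) : Loc (m + n) :=
  log.foldl (upd p) (Loc.start p op)

theorem fold_snoc (p : Fin (m + n)) (op : ℕ) (log : List (Resp m n)) (r : Resp m n) :
    fold p op (log ++ [r]) = upd p (fold p op log) r := by
  simp [fold]

theorem fold_c (p : Fin (m + n)) (op : ℕ) (log : List (Resp m n)) :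
    (fold p op log).c = log.length := by
  induction log using List.reverseRecOn with
  | nil => rfl
  | append_singleton l r ih => rw [fold_snoc, upd_c, ih]; simp

noncomputable def theImpl (m n : ℕ) : Impl (Fin (m + n)) ℕ ℕ (ℕ ⊕ (ℕ × Fin (m + n))) (Mem m n) where
  prog p op log :=
    if log.length < 4 * (m + n - 1) then .inl (nextOp p (fold p op log))
    else .inr ((fold p op log).val (m + n - 1))

theorem nextOp_ok (p : Fin (m + n)) (l : Loc (m + n)) (io : Σ i, (Mem m n i).Op)
    (hio : nextOp p l = io) :
    portOK m n (fun _ : ℕ => 0) (fun _ : ℕ × Fin (m + n) => ℕ) (fun _ => 0)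
      (rownF m n) (wownF m n) (fun r => r.2) p io.1 io.2 := by
  unfold nextOp at hio
  split_ifs at hio with h1 h2 h3 h4 h5 <;> subst hio
  · exact rfl
  · exact h3.choose_spec.symm
  · exact h4.choose_spec.symm
  · trivial
  · trivial
  · trivial

theorem issues (m n : ℕ) : IssuesOnly (theImpl m n)
    (portOK m n (fun _ : ℕ => 0) (fun _ : ℕ × Fin (m + n) => ℕ) (fun _ => 0)
      (rownF m n) (wownF m n) (fun r => r.2)) := by
  intro R t p _ _ op log i o _ hp
  simp only [theImpl] at hp
  split_ifs at hp
  exact nextOp_ok p (fold p op log) _ (Sum.inl.inj hp)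

theorem stepBound (R : Run (theImpl m n)) : StepBound R (4 * (m + n - 1)) := by
  intro t p o hinv b hb hret
  have key : ∀ b, t < b → b ≤ R.len → (∀ u r, t < u → u < b → ¬ RetAt R u p r) →
      ∃ op log, (R.cfg b).pst p = some (op, log) ∧
        ((Finset.Ioo t b).filter fun u => (R.ev u).isStepOf p).card = log.length ∧
        log.length ≤ 4 * (m + n - 1) := by
    intro b htb
    induction b, htb using Nat.le_induction with
    | base =>
      intro _ _
      have h := R.hstep t hinv.1
      rw [hinv.2] at h
      refine ⟨o, [], ?_, ?_, by simp⟩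
      · rw [h.2]; simp
      · have : Finset.Ioo t (t + 1) = ∅ := by ext u; simp
        rw [show t.succ = t + 1 from rfl, this]
        simp
    | succ b htb ih =>
      intro hb hr
      have htb : t < b := htb
      obtain ⟨op, log, h1, h2, h3⟩ := ih (by omega) (fun u r hu hu' => hr u r hu (by omega))
      have h := R.hstep b (by omega)
      have hI : Finset.Ioo t (b + 1) = insert b (Finset.Ioo t b) := by
        ext u; simp; omega
      rw [hI, Finset.filter_insert]
      cases e : R.ev b with
      | inv q op' =>
        rw [e] at h
        have hq : p ≠ q := by
          rintro rfl
          rw [h.1] at h1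
          cases h1
        refine ⟨op, log, ?_, ?_, h3⟩
        · rw [h.2]; simp [Function.update_of_ne hq, h1]
        · simpa [Ev.isStepOf] using h2
      | ret q r =>
        rw [e] at h
        obtain ⟨op', log', g1, g2, g3⟩ := h
        have hq : p ≠ q := by
          rintro rfl
          exact hr b r htb (by omega) ⟨by omega, e⟩
        refine ⟨op, log, ?_, ?_, h3⟩
        · rw [g3]; simp [Function.update_of_ne hq, h1]
        · simpa [Ev.isStepOf] using h2
      | step q =>
        rw [e] at h
        obtain ⟨op', log', i, o', g1, g2, g3⟩ := h
        by_cases hq : p = q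
        · subst hq
          rw [h1] at g1
          cases g1
          refine ⟨op, _, by rw [g3]; simp; rfl, ?_, ?_⟩
          · rw [if_pos (by simp [Ev.isStepOf]), Finset.card_insert_of_notMem (by simp), h2]
            simp
          · simp only [theImpl] at g2
            split_ifs at g2
            simp
            omega
        · refine ⟨op, log, ?_, ?_, h3⟩
          · rw [g3]; simp [Function.update_of_ne hq, h1]
          · simpa [Ev.isStepOf, Ne.symm hq] using h2
  by_cases htb : t < b
  · obtain ⟨op, log, -, h2, h3⟩ := key b htb hb hret
    omega
  · have : Finset.Ioo t b = ∅ := by ext u; simp; omega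
    simp [this]

abbrev MSt (m n : ℕ) : Type := ∀ i, (Mem m n i).St

def mR (M : MSt m n) (r : ℕ × Fin (m + n)) : ℕ := M (.inr r)
def mC (M : MSt m n) (s : ℕ) : ℕ × Finset (Fin m × ℕ) := M (.inl s)
def mX (M : MSt m n) (s : ℕ) : ℕ := (mC M s).1
def mA (M : MSt m n) (s : ℕ) : Finset (Fin m × ℕ) := (mC M s).2

def absS (M : MSt m n) (loc : Fin (m + n) → Option (Loc (m + n))) : AS m (m + n) :=
  ⟨mR M, mX M, mA M, loc⟩

theorem mR_upd_inl (M : MSt m n) (s : ℕ) (v : (Mem m n (.inl s)).St) :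
    mR (Function.update M (.inl s) v) = mR M := by
  funext r
  exact Function.update_of_ne (a := Sum.inr r) (a' := Sum.inl s) (by simp) v M

theorem mC_upd_same (M : MSt m n) (s : ℕ) (v : (Mem m n (.inl s)).St) :
    mC (Function.update M (.inl s) v) s = v := by
  exact Function.update_self (Sum.inl s) v M

theorem mC_upd_ne (M : MSt m n) (s r : ℕ) (h : r ≠ s) (v : (Mem m n (.inl s)).St) :
    mC (Function.update M (.inl s) v) r = mC M r := by
  exact Function.update_of_ne (a := Sum.inl r) (a' := Sum.inl s) (by simpa using h) v M

theorem mC_upd_inr (M : MSt m n) (s : ℕ × Fin (m + n)) (v : (Mem m n (.inr s)).St) :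
    mC (Function.update M (.inr s) v) = mC M := by
  funext r
  exact Function.update_of_ne (a := Sum.inl r) (a' := Sum.inr s) (by simp) v M

theorem mX_upd_inl (M : MSt m n) (s : ℕ) (v : ℕ × Finset (Fin m × ℕ)) :
    mX (Function.update M (.inl s) v) = Function.update (mX M) s v.1 := by
  funext r
  by_cases h : r = s
  · subst h
    rw [Function.update_self]
    exact congrArg Prod.fst (mC_upd_same M r v)
  · rw [Function.update_of_ne h]
    exact congrArg Prod.fst (mC_upd_ne M s r h v)

theorem mA_upd_inl (M : MSt m n) (s : ℕ) (v : ℕ × Finset (Fin m × ℕ)) :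
    mA (Function.update M (.inl s) v) = Function.update (mA M) s v.2 := by
  funext r
  by_cases h : r = s
  · subst h
    rw [Function.update_self]
    exact congrArg Prod.snd (mC_upd_same M r v)
  · rw [Function.update_of_ne h]
    exact congrArg Prod.snd (mC_upd_ne M s r h v)

theorem mR_upd_inr (M : MSt m n) (s : ℕ × Fin (m + n)) (v : ℕ) :
    mR (Function.update M (.inr s) v) = Function.update (mR M) s v := by
  funext r
  by_cases h : r = s
  · subst h
    rw [Function.update_self]
    exact Function.update_self (Sum.inr r) (show (Mem m n (.inr r)).St from v) M
  · rw [Function.update_of_ne h]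
    exact Function.update_of_ne (a := Sum.inr r) (a' := Sum.inr s) (by simpa using h)
      (show (Mem m n (.inr s)).St from v) M

theorem mX_upd_inr (M : MSt m n) (s : ℕ × Fin (m + n)) (v : (Mem m n (.inr s)).St) :
    mX (Function.update M (.inr s) v) = mX M := by
  funext r
  exact congrArg (fun f => (f r).1) (mC_upd_inr M s v)

theorem mA_upd_inr (M : MSt m n) (s : ℕ × Fin (m + n)) (v : (Mem m n (.inr s)).St) :
    mA (Function.update M (.inr s) v) = mA M := by
  funext r
  exact congrArg (fun f => (f r).2) (mC_upd_inr M s v)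

/-- Effect of a primitive on the memory, and its response. -/
def mEff (M : MSt m n) (io : Σ i, (Mem m n i).Op) : MSt m n :=
  Function.update M io.1 ((Mem m n io.1).δ (M io.1) io.2).1
def mRes (M : MSt m n) (io : Σ i, (Mem m n i).Op) : Resp m n :=
  ⟨io.1, ((Mem m n io.1).δ (M io.1) io.2).2⟩

theorem eff_audit (M : MSt m n) (s : ℕ) : mEff M (mkA s .audit) = M :=
  Function.update_eq_self _ _

theorem eff_rread (M : MSt m n) (r : ℕ × Fin (m + n)) : mEff M (mkR r .read) = M :=
  Function.update_eq_self _ _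

theorem abs_write (M : MSt m n) (r : ℕ × Fin (m + n)) (v : ℕ) (loc) :
    absS (mEff M (mkR r (.write v))) loc =
      { absS M loc with R := Function.update (mR M) r v } := by
  unfold absS mEff
  simp only [mX_upd_inr, mA_upd_inr]
  congr 1
  exact mR_upd_inr M r v

theorem abs_aread (M : MSt m n) (s : ℕ) (i : Fin m) (loc) :
    absS (mEff M (mkA s (.read i))) loc =
      { absS M loc with A := Function.update (mA M) s (insert (i, mX M s) (mA M s)) } := by
  unfold absS mEff
  simp only [mR_upd_inl]
  congr 1
  · refine (mX_upd_inl M s _).trans ?_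
    exact Function.update_eq_self _ _
  · exact mA_upd_inl M s _

theorem abs_awrite (M : MSt m n) (s : ℕ) (j : Fin n) (v : ℕ) (loc) :
    absS (mEff M (mkA s (.write j v))) loc =
      { absS M loc with X := Function.update (mX M) s v } := by
  unfold absS mEff
  simp only [mR_upd_inl]
  congr 1
  · exact mX_upd_inl M s _
  · refine (mA_upd_inl M s _).trans ?_
    exact Function.update_eq_self _ _

theorem pick_spec (p : Fin (m + n)) (s x : ℕ) (A : Finset (Fin m × ℕ)) :
    ((IsA (rownF m n) s p ∨ IsB (wownF m n) s p) → Zr A →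
      ∃ i, (i, 0) ∈ A ∧ rownF m n s i = pick p s x A) ∧
    ((IsA (rownF m n) s p ∨ IsB (wownF m n) s p) → ¬ Zr A →
      ∀ q : Fin (m + n), q.val + 1 = x → pick p s x A = q) ∧
    (¬ (IsA (rownF m n) s p ∨ IsB (wownF m n) s p) → pick p s x A = p) := by
  refine ⟨?_, ?_, ?_⟩
  · intro h1 h2
    refine ⟨h2.choose, h2.choose_spec, ?_⟩
    unfold pick
    rw [if_pos h1, dif_pos h2]
  · intro h1 h2 q hq
    unfold pick
    have h : ∃ q : Fin (m + n), q.val + 1 = x := ⟨q, hq⟩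
    rw [if_pos h1, dif_neg h2, dif_pos h]
    have := h.choose_spec
    apply Fin.ext
    omega
  · intro h
    unfold pick
    rw [if_neg h]

theorem conc_step {V : Set ℕ} (M : MSt m n) (loc : Fin (m + n) → Option (Loc (m + n)))
    (p : Fin (m + n)) (l : Loc (m + n)) (h : loc p = some l) :
    AStep (rownF m n) (wownF m n) V (absS M loc)
      (absS (mEff M (nextOp p l))
        (Function.update loc p (some (upd p l (mRes M (nextOp p l)))))) := by
  have h4 : l.c % 4 < 4 := Nat.mod_lt _ (by norm_num)
  have hd := Nat.div_add_mod l.c 4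
  by_cases c0 : l.c % 4 = 0
  · have e : nextOp p l = mkR (l.c / 4, p) (.write (l.val (l.c / 4))) := by
      unfold nextOp; rw [if_pos c0]
    have e2 : ∀ r, upd p l r = { l with c := l.c + 1 } := by
      intro r; unfold upd; rw [if_pos c0]
    rw [e2, e, abs_write]
    exact AStep.ann (σ := absS M loc) p l (l.c / 4) h (by omega)
  by_cases c1 : l.c % 4 = 1
  · have e2 : ∀ r, upd p l r = { l with
        c := l.c + 1, x := Function.update l.x (l.c / 4) (getX (p.val + 1) r) } := by
      intro r; unfold upd; rw [if_neg c0, if_pos c1]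
    by_cases hA : IsA (rownF m n) (l.c / 4) p
    · have e : nextOp p l = mkA (l.c / 4) (.read hA.choose) := by
        unfold nextOp; rw [if_neg c0, if_pos c1, dif_pos hA]
      rw [e2, e, abs_aread]
      exact AStep.rd (σ := absS M loc) p l (l.c / 4) hA.choose h (by omega) hA.choose_spec
    by_cases hB : IsB (wownF m n) (l.c / 4) p
    · have e : nextOp p l = mkA (l.c / 4) (.write hB.choose (p.val + 1)) := by
        unfold nextOp; rw [if_neg c0, if_pos c1, dif_neg hA, dif_pos hB]
      rw [e2, e, abs_awrite]
      exact AStep.wr (σ := absS M loc) p l (l.c / 4) h (by omega) hB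
    · have e : nextOp p l = mkA (l.c / 4) .audit := by
        unfold nextOp; rw [if_neg c0, if_pos c1, dif_neg hA, dif_neg hB]
      rw [e2, e, eff_audit]
      exact AStep.idle (σ := absS M loc) p l (l.c / 4) _ h (by omega) hA hB
  by_cases c2 : l.c % 4 = 2
  · have e2 : ∀ r, upd p l r = { l with
        c := l.c + 1,
        tgt := Function.update l.tgt (l.c / 4)
          (pick p (l.c / 4) (l.x (l.c / 4)) (getA r)) } := by
      intro r; unfold upd; rw [if_neg c0, if_neg c1, if_pos c2]
    have e : nextOp p l = mkA (l.c / 4) .audit := by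
      unfold nextOp; rw [if_neg c0, if_neg c1, if_pos c2]
    rw [e2, e, eff_audit]
    obtain ⟨h1, h2, h3⟩ := pick_spec p (l.c / 4) (l.x (l.c / 4)) (mA M (l.c / 4))
    exact AStep.aud (σ := absS M loc) p l (l.c / 4) _ h (by omega) h1 h2 h3
  · have e2 : ∀ r, upd p l r = { l with
        c := l.c + 1, val := Function.update l.val (l.c / 4 + 1) (getV r) } := by
      intro r; unfold upd; rw [if_neg c0, if_neg c1, if_neg c2]
    have e : nextOp p l = mkR (l.c / 4, l.tgt (l.c / 4)) .read := by
      unfold nextOp; rw [if_neg c0, if_neg c1, if_neg c2]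
    rw [e2, e, eff_rread]
    exact AStep.fin (σ := absS M loc) p l (l.c / 4) h (by omega)

theorem run_inv (R : Run (theImpl m n)) (hO : OneShot R) (t : ℕ) (ht : t ≤ R.len) :
    ∃ loc : Fin (m + n) → Option (Loc (m + n)),
      Inv (rownF m n) (wownF m n) {v | ∃ t' q, InvAt R t' q v} (absS (R.cfg t).mst loc) ∧
      (∀ p op log, (R.cfg t).pst p = some (op, log) → loc p = some (fold p op log)) ∧
      (∀ p, loc p ≠ none → ∃ u o, u < t ∧ InvAt R u p o) ∧
      (∀ u p r, u < t → RetAt R u p r → (R.cfg t).pst p = none ∧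
        ∃ l, loc p = some l ∧ 4 * (m + n - 1) ≤ l.c ∧ l.val (m + n - 1) = r) := by
  induction t with
  | zero =>
    refine ⟨fun _ => none, ?_, ?_, ?_, ?_⟩
    · rw [R.h0]
      refine ⟨?_, ?_, fun s i h => absurd h (Finset.notMem_empty _), fun s h => absurd rfl h,
        ?_, ?_, ?_, ?_, ?_⟩ <;> intro p l <;> intros <;> simp_all [absS]
    · rw [R.h0]
      intro p op log h
      cases h
    · intro p h
      exact absurd rfl h
    · intro u p r hu
      omega
  | succ t ih =>
    obtain ⟨loc, I, hp, hi, hr⟩ := ih (by omega)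
    have h := R.hstep t (by omega)
    cases e : R.ev t with
    | inv p op =>
      rw [e] at h
      obtain ⟨h1, h2⟩ := h
      have hat : InvAt R t p op := ⟨by omega, e⟩
      have hl : loc p = none := by
        by_contra hne
        obtain ⟨u, o, hu, hu'⟩ := hi p hne
        have := hO _ _ _ _ _ hu' hat
        omega
      refine ⟨Function.update loc p (some (Loc.start p op)), ?_, ?_, ?_, ?_⟩
      · rw [h2]
        exact inv_step _ _ (AStep.start (σ := absS (R.cfg t).mst loc) p op hl ⟨t, p, hat⟩) I
      · intro q op' log' hq
        rw [h2] at hq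
        by_cases eq : q = p
        · subst eq
          simp at hq
          obtain ⟨rfl, rfl⟩ := hq
          simp [fold]
        · simp only [Function.update_of_ne eq] at hq ⊢
          exact hp q op' log' hq
      · intro q hq
        by_cases eq : q = p
        · subst eq
          exact ⟨t, op, by omega, hat⟩
        · rw [Function.update_of_ne eq] at hq
          obtain ⟨u, o, hu, hu'⟩ := hi q hq
          exact ⟨u, o, by omega, hu'⟩
      · intro u q r hu hret
        have hut : u ≠ t := by
          rintro rfl
          rw [hret.2] at e
          cases e
        obtain ⟨g1, l, g2, g3⟩ := hr u q r (by omega) hret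
        have eq : q ≠ p := by
          rintro rfl
          rw [hl] at g2
          cases g2
        refine ⟨?_, l, ?_, g3⟩
        · rw [h2]
          simpa only [Function.update_of_ne eq] using g1
        · rw [Function.update_of_ne eq]
          exact g2
    | ret p r =>
      rw [e] at h
      obtain ⟨op, log, h1, h2, h3⟩ := h
      refine ⟨loc, ?_, ?_, ?_, ?_⟩
      · rw [h3]
        exact I
      · intro q op' log' hq
        rw [h3] at hq
        by_cases eq : q = p
        · subst eq
          simp at hq
        · simp only [Function.update_of_ne eq] at hq
          exact hp q op' log' hq
      · intro q hq
        obtain ⟨u, o, hu, hu'⟩ := hi q hq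
        exact ⟨u, o, by omega, hu'⟩
      · intro u q r' hu hret
        by_cases hut : u = t
        · subst hut
          rw [hret.2] at e
          cases e
          refine ⟨by rw [h3]; simp, _, hp _ _ _ h1, ?_⟩
          simp only [theImpl] at h2
          split_ifs at h2 with hlt
          rw [fold_c]
          exact ⟨by omega, Sum.inr.inj h2⟩
        · obtain ⟨g1, g2⟩ := hr u q r' (by omega) hret
          refine ⟨?_, g2⟩
          rw [h3]
          by_cases eq : q = p
          · subst eq; simp
          · simpa only [Function.update_of_ne eq] using g1
    | step p =>
      rw [e] at h
      obtain ⟨op, log, i, o, h1, h2, h3⟩ := h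
      have hl := hp _ _ _ h1
      have hn : nextOp p (fold p op log) = ⟨i, o⟩ := by
        simp only [theImpl] at h2
        split_ifs at h2 with hlt
        exact Sum.inl.inj h2
      have hs := conc_step (V := {v | ∃ t' q, InvAt R t' q v}) (R.cfg t).mst loc p _ hl
      rw [hn, ← fold_snoc] at hs
      refine ⟨Function.update loc p (some (fold p op (log ++ [mRes (R.cfg t).mst ⟨i, o⟩]))),
        ?_, ?_, ?_, ?_⟩
      · rw [h3]
        exact inv_step _ _ hs I
      · intro q op' log' hq
        rw [h3] at hq
        by_cases eq : q = p
        · subst eq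
          simp only [Function.update_self, Option.some.injEq, Prod.mk.injEq] at hq
          obtain ⟨rfl, rfl⟩ := hq
          rw [Function.update_self]
          rfl
        · simp only [Function.update_of_ne eq] at hq ⊢
          exact hp q op' log' hq
      · intro q hq
        have hq' : loc q ≠ none := by
          by_cases eq : q = p
          · subst eq
            rw [hl]
            simp
          · rwa [Function.update_of_ne eq] at hq
        obtain ⟨u, o, hu, hu'⟩ := hi q hq'
        exact ⟨u, o, by omega, hu'⟩
      · intro u q r hu hret
        have hut : u ≠ t := by
          rintro rfl
          rw [hret.2] at e
          cases e
        obtain ⟨g1, l, g2, g3⟩ := hr u q r (by omega) hret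
        have eq : q ≠ p := by
          rintro rfl
          rw [h1] at g1
          cases g1
        refine ⟨?_, l, ?_, g3⟩
        · rw [h3]
          simpa only [Function.update_of_ne eq] using g1
        · rw [Function.update_of_ne eq]
          exact g2

theorem safety (hm : 0 < m) (hn : 0 < n) (R : Run (theImpl m n)) (hO : OneShot R) :
    Agreement R ∧ Validity R := by
  obtain ⟨loc, I, -, -, hr⟩ := run_inv R hO R.len le_rfl
  constructor
  · intro t t' p q v v' h h'
    obtain ⟨-, l, hl, hc, rfl⟩ := hr t p v h.1 h
    obtain ⟨-, k, hk, hc', rfl⟩ := hr t' q v' h'.1 h'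
    refine inv_agree _ _ I (lab_ok m n hm hn) (m + n - 1) le_rfl p q l k hl hk hc hc' ?_
    unfold labF
    rw [if_neg (by omega), if_neg (by omega)]
  · intro t p v h
    obtain ⟨-, l, hl, hc, rfl⟩ := hr t p v h.1 h
    exact inv_valid _ _ I (m + n - 1) p l hl hc

end Concrete

end Aud


/-- Theorem 1.  For every pair of integers `m, n > 0`,
there is a wait-free algorithm solving consensus among `m + n` processes
using `n`-writer `m`-reader auditable registers (together with standard
single-writer multi-reader read/write registers): an implementation in which
every `propose` operation returns within a bounded number of the proposer's
own steps (wait-freedom), and in every one-shot run all decided values agree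
and are proposed values.  Consequently, the consensus number of the
`n`-writer `m`-reader auditable register is at least `m + n`. -/
theorem consensus_from_auditable_registers (m n : ℕ) (hm : 0 < m) (hn : 0 < n) :
    ∃ (C : ℕ) (Ia Ir : Type) (_ : DecidableEq Ia) (_ : DecidableEq Ir)
      (v0a : Ia → ℕ) (Vr : Ir → Type) (vr0 : ∀ r : Ir, Vr r)
      (impl : Impl (Fin (m + n)) ℕ ℕ (Ia ⊕ Ir)
        (Sum.elim (fun a : Ia => AudReg m n (v0a a))
                  (fun r : Ir => RWReg (Vr r) (vr0 r))))
      (rown : Ia → Fin m → Fin (m + n)) (wown : Ia → Fin n → Fin (m + n))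
      (regown : Ir → Fin (m + n)),
      -- the algorithm respects the access restrictions of the base objects
      IssuesOnly impl (portOK m n v0a Vr vr0 rown wown regown) ∧
      (∀ R : Run impl, StepBound R C) ∧
      -- consensus safety in every one-shot run
      (∀ R : Run impl, OneShot R → Agreement R ∧ Validity R) := by
  exact ⟨4 * (m + n - 1), ℕ, ℕ × Fin (m + n), inferInstance, inferInstance, fun _ => 0,
    fun _ => ℕ, fun _ => 0, Aud.theImpl m n, Aud.rownF m n, Aud.wownF m n, fun r => r.2,
    Aud.issues m n, fun R => Aud.stepBound R, fun R hO => Aud.safety hm hn R hO⟩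

end Shared
end

section
/- There is a wait-free linearizable implementation of an m-reader, n-writer auditable register from (m+n)-sliding registers and standard read/write registers, in which the step complexity of each READ, WRITE, and AUDIT operation is O(m+n). -/
namespace Shared

/-!
## STATEMENT 1: an `m`-reader `n`-writer auditable register from
`(m+n)`-sliding registers and standard read/write registers,
with `O(m+n)` step complexity per operation.
-/

/-- Operations of the auditable register. -/
inductive AOp where
  | read
  | write (v : ℕ)
  | audit

/-- Responses of the auditable register: the value returned by a READ, the
acknowledgement of a WRITE, or the set of (reader, value) pairs returned by
an AUDIT. -/
inductive ARes (m : ℕ) where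
  | val (v : ℕ)
  | ok
  | aset (A : Finset (Fin m × ℕ))

/-- The processes: `m` readers, `n` writers, `a` auditors. -/
abbrev ARProc (m n a : ℕ) := Fin m ⊕ Fin n ⊕ Fin a

/-- Sequential specification of the `m`-reader `n`-writer auditable register
with initial value `v0`: the state is the current value together with the set
of (reader, value) pairs of the READs performed so far; a READ by reader `i`
returns the current value `v` and records `(i, v)`; a WRITE sets the value;
an AUDIT returns exactly the pairs of the preceding READs. -/
def auditSpec (m n a : ℕ) (v0 : ℕ) : SeqSpec (ARProc m n a) AOp (ARes m) where
  St := ℕ × Finset (Fin m × ℕ)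
  init := (v0, ∅)
  δ := fun s p o =>
    match p, o with
    | .inl i, .read => ((s.1, insert (i, s.1) s.2), .val s.1)
    | .inr (.inl _), .write v => ((v, s.2), .ok)
    | _, .audit => (s, .aset s.2)
    | _, _ => (s, .ok)

/-- Role restrictions: the register is read by the `m` readers, written by
the `n` writers and audited by all processes. -/
def ARLegal (m n a : ℕ) : ARProc m n a → AOp → Prop
  | .inl _, .read => True
  | .inr (.inl _), .write _ => True
  | _, .audit => True
  | _, _ => False

/-! ## A universal construction with read-only operations -/

section Universal

/-- Parameters of the universal construction. `own p o = some q` means that operation `o` of `p`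
is an update handled by the core process `q`; `own p o = none` means that it is read-only. -/
structure Par (P HOp HRes : Type) where
  spec : SeqSpec P HOp HRes
  k : ℕ
  pid : Fin k → P
  own : P → HOp → Option (Fin k)
  own_pid : ∀ p o q, own p o = some q → p = pid q
  pid_inj : Function.Injective pid
  own_none : ∀ p o, own p o = none → ∀ s, (spec.δ s p o).1 = s

/-- A history entry. -/
structure Entry (k : ℕ) (HOp : Type) where
  q : Fin k
  n : ℕ
  op : HOp

/-- The identity of a history entry. -/
def Entry.key {k : ℕ} {HOp : Type} (e : Entry k HOp) : Fin k × ℕ := (e.q, e.n)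

/-- Content of the plain registers. -/
structure Reg (k : ℕ) (HOp : Type) where
  num : ℕ
  hist : List (Entry k HOp)
  op : Option HOp

/-- Local states. -/
inductive Loc (k : ℕ) (HOp : Type) where
  | rd0 (q : Fin k)
  | wr0 (q : Fin k) (n : ℕ)
  | colM (md : Option (Fin k × ℕ)) (i j : ℕ) (h : List (Entry k HOp))
  | colA (q : Fin k) (n r j i : ℕ) (acc : List (Entry k HOp))
  | rdS (q : Fin k) (n r j : ℕ)
  | wrP (q : Fin k) (n r j : ℕ) (h : List (Entry k HOp))
  | done (q : Fin k) (n : ℕ) (h : List (Entry k HOp))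
  | doneRO (h : List (Entry k HOp))

/-- The base objects. -/
abbrev UMem (k : ℕ) (HOp : Type) : ℕ ⊕ (Fin k ⊕ Fin k) → ObjType :=
  Sum.elim (fun _ : ℕ => SlidingReg k (Fin k × List (Entry k HOp)))
    (fun _ : Fin k ⊕ Fin k => RWReg (Reg k HOp) ⟨0, [], none⟩)

/-- Responses of base objects. -/
abbrev UResp (k : ℕ) (HOp : Type) := Σ i : ℕ ⊕ (Fin k ⊕ Fin k), (UMem k HOp i).Res

def getReg {k : ℕ} {HOp : Type} : UResp k HOp → Reg k HOp
  | ⟨.inr _, x⟩ => Option.getD x ⟨0, [], none⟩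
  | ⟨.inl _, _⟩ => ⟨0, [], none⟩

def getS {k : ℕ} {HOp : Type} : UResp k HOp → List (Fin k × List (Entry k HOp))
  | ⟨.inl _, x⟩ => x
  | ⟨.inr _, _⟩ => []

/-- History at the head of a sliding register. -/
def headH {k : ℕ} {HOp : Type} (d : List (Entry k HOp)) :
    List (Fin k × List (Entry k HOp)) → List (Entry k HOp)
  | [] => d
  | x :: _ => x.2

/-- Add an announced operation to a history, if it is not already there. -/
def addE {k : ℕ} {HOp : Type} (acc : List (Entry k HOp)) (q : Fin k) (r : Reg k HOp) :
    List (Entry k HOp) :=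
  match r.op with
  | none => acc
  | some o => if (q, r.num) ∈ acc.map Entry.key then acc else acc ++ [⟨q, r.num, o⟩]

variable {P HOp HRes : Type}

namespace Par

variable (G : Par P HOp HRes)

/-- Specification state after a history. -/
def st (h : List (Entry G.k HOp)) : G.spec.St :=
  h.foldl (fun s e => (G.spec.δ s (G.pid e.q) e.op).1) G.spec.init

def start (p : P) (op : HOp) : Loc G.k HOp :=
  match G.own p op with
  | some q => .rd0 q
  | none => .colM none 0 0 []

def next (p : P) (op : HOp) : Loc G.k HOp → (Σ i, (UMem G.k HOp i).Op) ⊕ HRes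
  | .rd0 q => .inl ⟨.inr (.inr q), RegOp.read⟩
  | .wr0 q n => .inl ⟨.inr (.inr q), RegOp.write (⟨n + 1, [], some op⟩ : Reg G.k HOp)⟩
  | .colM _ i j _ =>
      if hi : i < G.k then .inl ⟨.inr (.inl ⟨i, hi⟩), RegOp.read⟩
      else .inl ⟨.inl j, RegOp.read⟩
  | .colA q _ _ j i acc =>
      if hi : i < G.k then .inl ⟨.inr (.inr ⟨i, hi⟩), RegOp.read⟩
      else .inl ⟨.inl j, RegOp.write ((q, acc) : Fin G.k × List (Entry G.k HOp))⟩
  | .rdS _ _ _ j => .inl ⟨.inl j, RegOp.read⟩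
  | .wrP q _ _ j h => .inl ⟨.inr (.inl q), RegOp.write (⟨j + 1, h, none⟩ : Reg G.k HOp)⟩
  | .done q n h =>
      .inr (G.spec.δ (G.st (h.takeWhile fun e => decide (e.key ≠ (q, n)))) p op).2
  | .doneRO h => .inr (G.spec.δ (G.st h) p op).2

def upd (l : Loc G.k HOp) (x : UResp G.k HOp) : Loc G.k HOp :=
  match l with
  | .rd0 q => .wr0 q (getReg x).num
  | .wr0 q n => .colM (some (q, n + 1)) 0 0 []
  | .colM md i j h =>
      if i < G.k then
        if j ≤ (getReg x).num then .colM md (i + 1) (getReg x).num (getReg x).hist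
        else .colM md (i + 1) j h
      else match md with
        | none => .doneRO (headH h (getS x))
        | some (q, n) => .colA q n 0 j 0 h
  | .colA q n r j i acc =>
      if hi : i < G.k then .colA q n r j (i + 1) (addE acc ⟨i, hi⟩ (getReg x))
      else .rdS q n r j
  | .rdS q n r j => .wrP q n r j (headH [] (getS x))
  | .wrP q n r j h => if r < 2 then .colA q n (r + 1) (j + 1) 0 h else .done q n h
  | .done q n h => .done q n h
  | .doneRO h => .doneRO h

def impl : Impl P HOp HRes (ℕ ⊕ (Fin G.k ⊕ Fin G.k)) (UMem G.k HOp) where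
  prog := fun p op log => G.next p op (log.foldl G.upd (G.start p op))

end Par

/-- Abstract states. -/
@[ext]
structure AS (P HOp : Type) (k : ℕ) where
  S : ℕ → List (Fin k × List (Entry k HOp))
  pos : Fin k → Reg k HOp
  ann : Fin k → Reg k HOp
  loc : P → Option (HOp × Loc k HOp)

variable [DecidableEq P]

/-- Abstract steps. -/
inductive AStep (G : Par P HOp HRes) : AS P HOp G.k → Ev P HOp HRes → AS P HOp G.k → Prop
  | inv (s) (p op) : s.loc p = none →
      AStep G s (.inv p op) { s with loc := Function.update s.loc p (some (op, G.start p op)) }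
  | rd0 (s) (p op q) : s.loc p = some (op, .rd0 q) →
      AStep G s (.step p)
        { s with loc := Function.update s.loc p (some (op, .wr0 q (s.ann q).num)) }
  | wr0 (s) (p op q n) : s.loc p = some (op, .wr0 q n) →
      AStep G s (.step p)
        { s with
          ann := Function.update s.ann q ⟨n + 1, [], some op⟩
          loc := Function.update s.loc p (some (op, .colM (some (q, n + 1)) 0 0 [])) }
  | colM1 (s) (p op md i j h) (q : Fin G.k) : s.loc p = some (op, .colM md i j h) → q.val = i →
      j ≤ (s.pos q).num →
      AStep G s (.step p)
        { s with loc := Function.update s.loc p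
                  (some (op, .colM md (i + 1) (s.pos q).num (s.pos q).hist)) }
  | colM2 (s) (p op md i j h) (q : Fin G.k) : s.loc p = some (op, .colM md i j h) → q.val = i →
      (s.pos q).num < j →
      AStep G s (.step p)
        { s with loc := Function.update s.loc p (some (op, .colM md (i + 1) j h)) }
  | colM3 (s) (p op i j h) : s.loc p = some (op, .colM none i j h) → G.k ≤ i →
      AStep G s (.step p)
        { s with loc := Function.update s.loc p (some (op, .doneRO (headH h (s.S j)))) }
  | colM4 (s) (p op q n i j h) : s.loc p = some (op, .colM (some (q, n)) i j h) → G.k ≤ i →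
      AStep G s (.step p)
        { s with loc := Function.update s.loc p (some (op, .colA q n 0 j 0 h)) }
  | colA1 (s) (p op q n r j i acc) (q' : Fin G.k) : s.loc p = some (op, .colA q n r j i acc) →
      q'.val = i →
      AStep G s (.step p)
        { s with loc := Function.update s.loc p
                  (some (op, .colA q n r j (i + 1) (addE acc q' (s.ann q')))) }
  | colA2 (s) (p op q n r j i acc) : s.loc p = some (op, .colA q n r j i acc) → G.k ≤ i →
      AStep G s (.step p)
        { s with
          S := Function.update s.S j ((s.S j ++ [(q, acc)]).drop ((s.S j).length + 1 - G.k))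
          loc := Function.update s.loc p (some (op, .rdS q n r j)) }
  | rdS (s) (p op q n r j) : s.loc p = some (op, .rdS q n r j) →
      AStep G s (.step p)
        { s with loc := Function.update s.loc p (some (op, .wrP q n r j (headH [] (s.S j)))) }
  | wrP1 (s) (p op q n r j h) : s.loc p = some (op, .wrP q n r j h) → r < 2 →
      AStep G s (.step p)
        { s with
          pos := Function.update s.pos q ⟨j + 1, h, none⟩
          loc := Function.update s.loc p (some (op, .colA q n (r + 1) (j + 1) 0 h)) }
  | wrP2 (s) (p op q n r j h) : s.loc p = some (op, .wrP q n r j h) → 2 ≤ r →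
      AStep G s (.step p)
        { s with
          pos := Function.update s.pos q ⟨j + 1, h, none⟩
          loc := Function.update s.loc p (some (op, .done q n h)) }
  | ret1 (s) (p op q n h) : s.loc p = some (op, .done q n h) →
      AStep G s (.ret p
          (G.spec.δ (G.st (h.takeWhile fun e => decide (e.key ≠ (q, n)))) p op).2)
        { s with loc := Function.update s.loc p none }
  | ret2 (s) (p op h) : s.loc p = some (op, .doneRO h) →
      AStep G s (.ret p (G.spec.δ (G.st h) p op).2)
        { s with loc := Function.update s.loc p none }

/-- The abstraction of a configuration. -/
def absC (G : Par P HOp HRes) (c : Cfg P HOp (ℕ ⊕ (Fin G.k ⊕ Fin G.k)) (UMem G.k HOp)) :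
    AS P HOp G.k where
  S := fun j => c.mst (.inl j)
  pos := fun q => c.mst (.inr (.inl q))
  ann := fun q => c.mst (.inr (.inr q))
  loc := fun p => (c.pst p).map fun x => (x.1, x.2.foldl G.upd (G.start p x.1))

theorem loc_update (G : Par P HOp HRes)
    (pst : P → Option (HOp × List (UResp G.k HOp))) (p : P) (y : Option (HOp × List (UResp G.k HOp))) :
    (fun p' => (Function.update pst p y p').map
      fun x => (x.1, x.2.foldl G.upd (G.start p' x.1))) =
    Function.update (fun p' => (pst p').map
      fun x => (x.1, x.2.foldl G.upd (G.start p' x.1))) p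
      (y.map fun x => (x.1, x.2.foldl G.upd (G.start p x.1))) := by
  funext p'
  by_cases h : p' = p
  · subst h; simp
  · simp [h]

theorem upd_self_eq {α : Type*} {β : α → Type*} [DecidableEq α] (f : ∀ a, β a) (a : α) :
    Function.update f a (f a) = f := Function.update_eq_self a f

theorem absC_step (G : Par P HOp HRes)
    (c c' : Cfg P HOp (ℕ ⊕ (Fin G.k ⊕ Fin G.k)) (UMem G.k HOp)) (e : Ev P HOp HRes)
    (h : EStep G.impl c e c') : AStep G (absC G c) e (absC G c') := by
  cases e with
  | inv p op =>
    obtain ⟨h1, rfl⟩ := h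
    have := AStep.inv (G := G) (absC G c) p op (by simp [absC, h1])
    convert this using 1
    ext1 <;> try rfl
    simp only [absC, loc_update]; rfl
  | step p =>
    obtain ⟨op, log, i, o, h1, h2, rfl⟩ := h
    have hl : (absC G c).loc p = some (op, log.foldl G.upd (G.start p op)) := by simp [absC, h1]
    simp only [Par.impl] at h2
    generalize hL : log.foldl G.upd (G.start p op) = l at hl h2
    have hloc : (absC G ⟨Function.update c.mst i ((UMem G.k HOp i).δ (c.mst i) o).1,
              Function.update c.pst p
                (some (op, log ++ [⟨i, ((UMem G.k HOp i).δ (c.mst i) o).2⟩]))⟩).loc =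
        Function.update (absC G c).loc p
          (some (op, G.upd l ⟨i, ((UMem G.k HOp i).δ (c.mst i) o).2⟩)) := by
      simp only [absC, loc_update, Option.map_some, List.foldl_append, hL]; rfl
    generalize hC : (⟨Function.update c.mst i ((UMem G.k HOp i).δ (c.mst i) o).1,
              Function.update c.pst p
                (some (op, log ++ [⟨i, ((UMem G.k HOp i).δ (c.mst i) o).2⟩]))⟩ :
                Cfg P HOp (ℕ ⊕ (Fin G.k ⊕ Fin G.k)) (UMem G.k HOp)) = c' at hloc ⊢
    have hS : (absC G c').S = fun j => Function.update c.mst i ((UMem G.k HOp i).δ (c.mst i) o).1 (.inl j) := by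
      rw [← hC]; rfl
    have hP : (absC G c').pos = fun j => Function.update c.mst i ((UMem G.k HOp i).δ (c.mst i) o).1 (.inr (.inl j)) := by
      rw [← hC]; rfl
    have hA : (absC G c').ann = fun j => Function.update c.mst i ((UMem G.k HOp i).δ (c.mst i) o).1 (.inr (.inr j)) := by
      rw [← hC]; rfl
    clear hC
    generalize absC G c' = s' at *
    have rdcase : ∀ (i : ℕ ⊕ (Fin G.k ⊕ Fin G.k)) (o : (UMem G.k HOp i).Op),
        ((UMem G.k HOp i).δ (c.mst i) o).1 = c.mst i →
        s'.S = (fun j => Function.update c.mst i ((UMem G.k HOp i).δ (c.mst i) o).1 (.inl j)) →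
        s'.pos = (fun j => Function.update c.mst i ((UMem G.k HOp i).δ (c.mst i) o).1 (.inr (.inl j))) →
        s'.ann = (fun j => Function.update c.mst i ((UMem G.k HOp i).δ (c.mst i) o).1 (.inr (.inr j))) →
        s' = { absC G c with loc := s'.loc } := by
      intro i o e1 e2 e3 e4
      rw [e1, Function.update_eq_self] at e2 e3 e4
      ext1
      · exact e2
      · exact e3
      · exact e4
      · rfl
    cases l with
    | rd0 q =>
      cases h2
      rw [rdcase _ _ rfl hS hP hA, hloc]
      exact AStep.rd0 (absC G c) p op q hl
    | wr0 q n =>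
      cases h2
      convert AStep.wr0 (G := G) (absC G c) p op q n hl using 1
      ext1
      · rw [hS]; rfl
      · rw [hP]; funext j; exact Function.update_of_ne (by simp) _ _
      · rw [hA]; funext j
        by_cases hj : j = q
        · subst hj; refine (Function.update_self _ _ _).trans ?_; simp only [Function.update_self]; rfl
        · refine (Function.update_of_ne (by simpa using hj) _ _).trans ?_; simp only [Function.update_of_ne hj]; rfl
      · exact hloc
    | colM md i j h =>
      simp only [Par.next] at h2
      split at h2
      · rename_i hi
        cases h2
        rw [rdcase _ _ rfl hS hP hA, hloc]
        by_cases hj : j ≤ (c.mst (.inr (.inl ⟨i, hi⟩)) : Reg G.k HOp).num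
        · convert AStep.colM1 (absC G c) p op md i j h ⟨i, hi⟩ hl rfl hj using 1
          simp only [Par.upd, if_pos hi]
          congr 4
          exact if_pos hj
        · convert AStep.colM2 (absC G c) p op md i j h ⟨i, hi⟩ hl rfl (not_le.mp hj) using 1
          simp only [Par.upd, if_pos hi]
          congr 4
          exact if_neg hj
      · rename_i hi
        cases h2
        rw [rdcase _ _ rfl hS hP hA, hloc]
        cases md with
        | none =>
          convert AStep.colM3 (absC G c) p op i j h hl (not_lt.mp hi) using 1
          simp only [Par.upd, if_neg hi]
          rfl
        | some x =>
          obtain ⟨q, n⟩ := x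
          convert AStep.colM4 (absC G c) p op q n i j h hl (not_lt.mp hi) using 1
          simp only [Par.upd, if_neg hi]
    | colA q n r j i acc =>
      simp only [Par.next] at h2
      split at h2
      · rename_i hi
        cases h2
        rw [rdcase _ _ rfl hS hP hA, hloc]
        convert AStep.colA1 (absC G c) p op q n r j i acc ⟨i, hi⟩ hl rfl using 1
        simp only [Par.upd, dif_pos hi]
        rfl
      · rename_i hi
        cases h2
        convert AStep.colA2 (absC G c) p op q n r j i acc hl (not_lt.mp hi) using 1
        ext1
        · rw [hS]; funext j'
          by_cases hj : j' = j
          · subst hj; refine (Function.update_self _ _ _).trans ?_; simp only [Function.update_self]; rfl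
          · refine (Function.update_of_ne (by simpa using hj) _ _).trans ?_; simp only [Function.update_of_ne hj]; rfl
        · rw [hP]; funext j; exact Function.update_of_ne (by simp) _ _
        · rw [hA]; funext j; exact Function.update_of_ne (by simp) _ _
        · simp only [hloc, Par.upd, dif_neg hi]
    | rdS q n r j =>
      cases h2
      rw [rdcase _ _ rfl hS hP hA, hloc]
      exact AStep.rdS (absC G c) p op q n r j hl
    | wrP q n r j h =>
      cases h2
      have e1 : s'.S = (absC G c).S := by rw [hS]; rfl
      have e2 : s'.ann = (absC G c).ann := by rw [hA]; funext j; exact Function.update_of_ne (by simp) _ _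
      have e3 : s'.pos = Function.update (absC G c).pos q ⟨j + 1, h, none⟩ := by
        rw [hP]; funext j
        by_cases hj : j = q
        · subst hj; refine (Function.update_self _ _ _).trans ?_; simp only [Function.update_self]; rfl
        · refine (Function.update_of_ne (by simpa using hj) _ _).trans ?_; simp only [Function.update_of_ne hj]; rfl
      by_cases hr : r < 2
      · convert AStep.wrP1 (absC G c) p op q n r j h hl hr using 1
        ext1
        · exact e1
        · exact e3
        · exact e2
        · simp only [hloc, Par.upd, if_pos hr]
      · convert AStep.wrP2 (absC G c) p op q n r j h hl (not_lt.mp hr) using 1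
        ext1
        · exact e1
        · exact e3
        · exact e2
        · simp only [hloc, Par.upd, if_neg hr]
    | done q n h => simp [Par.next] at h2
    | doneRO h => simp [Par.next] at h2
  | ret p r =>
    obtain ⟨op, log, h1, h2, rfl⟩ := h
    have hl : (absC G c).loc p = some (op, log.foldl G.upd (G.start p op)) := by simp [absC, h1]
    have hC : absC G { c with pst := Function.update c.pst p none } =
        { absC G c with loc := Function.update (absC G c).loc p none } := by
      ext1 <;> try rfl
      simp only [absC, loc_update]; rfl
    rw [hC]
    simp only [Par.impl] at h2
    generalize log.foldl G.upd (G.start p op) = l at hl h2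
    cases l with
    | done q n h =>
      cases h2
      exact AStep.ret1 (absC G c) p op q n h hl
    | doneRO h =>
      cases h2
      exact AStep.ret2 (absC G c) p op h hl
    | colM md i j h => simp only [Par.next] at h2; split at h2 <;> simp at h2
    | colA q n r j i acc => simp only [Par.next] at h2; split at h2 <;> simp at h2
    | rd0 q => simp [Par.next] at h2
    | wr0 q n => simp [Par.next] at h2
    | rdS q n r j => simp [Par.next] at h2
    | wrP q n r j h => simp [Par.next] at h2

/-- History decided before slot `j`. -/
def Hs {k : ℕ} (s : AS P HOp k) : ℕ → List (Entry k HOp)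
  | 0 => []
  | j + 1 => headH [] (s.S j)

/-- Local invariant of a pending operation. -/
def LI (G : Par P HOp HRes) (s : AS P HOp G.k) (D : ℕ) (p : P) (op : HOp) : Loc G.k HOp → Prop
  | .rd0 q => G.own p op = some q
  | .wr0 q n => G.own p op = some q ∧ n = (s.ann q).num
  | .colM md i j h => j ≤ D ∧ h = Hs s j ∧ (j ≠ 0 → ∃ q', j ≤ (s.pos q').num) ∧
      (md = none → G.own p op = none) ∧
      (∀ q n, md = some (q, n) → G.own p op = some q ∧ s.ann q = ⟨n, [], some op⟩ ∧ n ≠ 0 ∧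
        (q.val < i → (s.pos q).num ≤ j))
  | .colA q n _ j _ acc => G.own p op = some q ∧ s.ann q = ⟨n, [], some op⟩ ∧ n ≠ 0 ∧
      (s.pos q).num ≤ j ∧ j ≤ D ∧ Hs s j <+: acc ∧ (j ≠ 0 → ∃ q', j ≤ (s.pos q').num)
  | .rdS q n _ j => G.own p op = some q ∧ s.ann q = ⟨n, [], some op⟩ ∧ n ≠ 0 ∧
      (s.pos q).num ≤ j ∧ j < D
  | .wrP q n _ j h => G.own p op = some q ∧ s.ann q = ⟨n, [], some op⟩ ∧ n ≠ 0 ∧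
      (s.pos q).num ≤ j ∧ j < D ∧ h = Hs s (j + 1)
  | .done q n h => G.own p op = some q ∧ s.ann q = ⟨n, [], some op⟩ ∧ n ≠ 0 ∧
      ∃ j, j ≤ D ∧ h = Hs s j
  | .doneRO h => G.own p op = none ∧ ∃ j, j ≤ D ∧ h = Hs s j

/-- The process is between its write to slot `j` and the update of its position. -/
def Mid {k : ℕ} (q : Fin k) (j : ℕ) (y : Option (HOp × Loc k HOp)) : Prop :=
  ∃ op n r, y = some (op, .rdS q n r j) ∨ ∃ h, y = some (op, .wrP q n r j h)

/-- Global invariant. -/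
structure GInv (G : Par P HOp HRes) (s : AS P HOp G.k) (D : ℕ) : Prop where
  dec : ∀ j, s.S j ≠ [] ↔ j < D
  ext : ∀ j x, x ∈ s.S j → Hs s j <+: x.2
  nodup : ∀ j, ((s.S j).map Prod.fst).Nodup
  tag : ∀ j x, x ∈ s.S j → j < (s.pos x.1).num ∨ Mid x.1 j (s.loc (G.pid x.1))
  posH : ∀ q, (s.pos q).num ≤ D ∧ (s.pos q).hist = Hs s (s.pos q).num
  lead : ∀ j, j < D → j ≠ 0 → ∃ q, j ≤ (s.pos q).num
  loc : ∀ p op l, s.loc p = some (op, l) → LI G s D p op l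

/-- Monotone evolution. -/
structure Ext {k : ℕ} (s : AS P HOp k) (D : ℕ) (s' : AS P HOp k) (D' : ℕ) : Prop where
  D_le : D ≤ D'
  H_eq : ∀ j, j ≤ D → Hs s' j = Hs s j
  pos_le : ∀ q, (s.pos q).num ≤ (s'.pos q).num
  ann_le : ∀ q, (s.ann q).num ≤ (s'.ann q).num

theorem Ext.refl {k : ℕ} (s : AS P HOp k) (D : ℕ) : Ext s D s D :=
  ⟨le_rfl, fun _ _ => rfl, fun _ => le_rfl, fun _ => le_rfl⟩

theorem Ext.trans {k : ℕ} {s s' s'' : AS P HOp k} {D D' D'' : ℕ} (h : Ext s D s' D')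
    (h' : Ext s' D' s'' D'') : Ext s D s'' D'' :=
  ⟨h.D_le.trans h'.D_le, fun j hj => (h'.H_eq j (hj.trans h.D_le)).trans (h.H_eq j hj),
    fun q => (h.pos_le q).trans (h'.pos_le q), fun q => (h.ann_le q).trans (h'.ann_le q)⟩

theorem LI_frame {G : Par P HOp HRes} {s s' : AS P HOp G.k} {D D' : ℕ} {p : P} {op : HOp}
    {l : Loc G.k HOp} (h : LI G s D p op l) (hE : Ext s D s' D')
    (hq : ∀ q, G.own p op = some q → s'.pos q = s.pos q ∧ s'.ann q = s.ann q) :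
    LI G s' D' p op l := by
  have hD := hE.D_le
  have hex : ∀ j, (∃ q', j ≤ (s.pos q').num) → ∃ q', j ≤ (s'.pos q').num :=
    fun j ⟨q', h⟩ => ⟨q', h.trans (hE.pos_le q')⟩
  cases l with
  | rd0 q => exact h
  | wr0 q n => exact ⟨h.1, by rw [(hq q h.1).2]; exact h.2⟩
  | colM md i j hh =>
    obtain ⟨h1, h2, h3, h4, h5⟩ := h
    refine ⟨h1.trans hD, by rw [hE.H_eq j h1]; exact h2, fun hj => hex _ (h3 hj), h4, ?_⟩
    intro q n hm
    obtain ⟨a, b, c, d⟩ := h5 q n hm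
    rw [(hq q a).1, (hq q a).2]
    exact ⟨a, b, c, d⟩
  | colA q n r j i acc =>
    obtain ⟨h1, h2, h3, h4, h5, h6, h7⟩ := h
    refine ⟨h1, by rw [(hq q h1).2]; exact h2, h3, by rw [(hq q h1).1]; exact h4, h5.trans hD,
      by rw [hE.H_eq j h5]; exact h6, fun hj => hex _ (h7 hj)⟩
  | rdS q n r j =>
    obtain ⟨h1, h2, h3, h4, h5⟩ := h
    exact ⟨h1, by rw [(hq q h1).2]; exact h2, h3, by rw [(hq q h1).1]; exact h4, by omega⟩
  | wrP q n r j hh =>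
    obtain ⟨h1, h2, h3, h4, h5, h6⟩ := h
    exact ⟨h1, by rw [(hq q h1).2]; exact h2, h3, by rw [(hq q h1).1]; exact h4, by omega,
      by rw [hE.H_eq _ h5]; exact h6⟩
  | done q n hh =>
    obtain ⟨h1, h2, h3, j, h4, h5⟩ := h
    exact ⟨h1, by rw [(hq q h1).2]; exact h2, h3, j, h4.trans hD, by rw [hE.H_eq j h4]; exact h5⟩
  | doneRO hh =>
    obtain ⟨h1, j, h4, h5⟩ := h
    exact ⟨h1, j, h4.trans hD, by rw [hE.H_eq j h4]; exact h5⟩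

/-- Steps which only modify the local state. -/
theorem GInv_loc {G : Par P HOp HRes} {s : AS P HOp G.k} {D : ℕ} (h : GInv G s D) (p : P)
    (y : Option (HOp × Loc G.k HOp))
    (hy : ∀ op l, y = some (op, l) → LI G s D p op l)
    (ht : ∀ q j, Mid q j (s.loc p) → Mid q j y) :
    GInv G { s with loc := Function.update s.loc p y } D where
  dec := h.dec
  ext := h.ext
  nodup := h.nodup
  tag := by
    intro j x hx
    refine (h.tag j x hx).imp id ?_
    intro hM
    by_cases hp : G.pid x.1 = p
    · subst hp; simpa using ht _ _ hM
    · simpa [hp] using hM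
  posH := h.posH
  lead := h.lead
  loc := by
    intro p' op l hl
    by_cases hp : p' = p
    · subst hp
      simp only [Function.update_self] at hl
      exact hy op l hl
    · simp only [Function.update_of_ne hp] at hl
      exact h.loc p' op l hl

theorem Ext_loc {k : ℕ} (s : AS P HOp k) (D : ℕ) (f : P → Option (HOp × Loc k HOp)) :
    Ext s D { s with loc := f } D :=
  ⟨le_rfl, fun j _ => by cases j <;> rfl, fun _ => le_rfl, fun _ => le_rfl⟩

theorem headH_append {k : ℕ} (d : List (Entry k HOp)) (l l' : List (Fin k × List (Entry k HOp)))
    (h : l ≠ []) : headH d (l ++ l') = headH d l := by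
  cases l with
  | nil => exact absurd rfl h
  | cons a l => rfl

theorem headH_mem {k : ℕ} (d : List (Entry k HOp)) (l : List (Fin k × List (Entry k HOp)))
    (h : l ≠ []) : ∃ x ∈ l, headH d l = x.2 := by
  cases l with
  | nil => exact absurd rfl h
  | cons a l => exact ⟨a, by simp, rfl⟩

theorem addE_prefix {k : ℕ} (acc : List (Entry k HOp)) (q : Fin k) (r : Reg k HOp) :
    acc <+: addE acc q r := by
  unfold addE
  split
  · exact List.prefix_rfl
  · split
    · exact List.prefix_rfl
    · exact List.prefix_append _ _

theorem not_mid {k : ℕ} {q : Fin k} {j : ℕ} {op : HOp} {l : Loc k HOp}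
    (h : Mid q j (some (op, l))) : (∃ n r, l = .rdS q n r j) ∨ ∃ n r h, l = .wrP q n r j h := by
  obtain ⟨op', n, r, h | ⟨hh, h⟩⟩ := h
  · left; simp only [Option.some.injEq, Prod.mk.injEq] at h; exact ⟨n, r, h.2⟩
  · right; simp only [Option.some.injEq, Prod.mk.injEq] at h; exact ⟨n, r, hh, h.2⟩

/-- The update of the position. -/
theorem GInv_pos {G : Par P HOp HRes} {s : AS P HOp G.k} {D : ℕ} (h : GInv G s D) (p : P)
    {op : HOp} {q : Fin G.k} {n r j : ℕ} {hh : List (Entry G.k HOp)}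
    (hl : s.loc p = some (op, .wrP q n r j hh)) (l : Loc G.k HOp)
    (hy : LI G { s with pos := Function.update s.pos q ⟨j + 1, hh, none⟩ } D p op l) :
    GInv G { s with
          pos := Function.update s.pos q ⟨j + 1, hh, none⟩
          loc := Function.update s.loc p (some (op, l)) } D ∧
    Ext s D { s with
          pos := Function.update s.pos q ⟨j + 1, hh, none⟩
          loc := Function.update s.loc p (some (op, l)) } D := by
  obtain ⟨h1, h2, h3, h4, h5, h6⟩ := h.loc _ _ _ hl
  have hpq := G.own_pid _ _ _ h1
  have hE : Ext s D { s with
          pos := Function.update s.pos q ⟨j + 1, hh, none⟩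
          loc := Function.update s.loc p (some (op, l)) } D := by
    refine ⟨le_rfl, fun j _ => by cases j <;> rfl, ?_, fun _ => le_rfl⟩
    intro q'
    by_cases hq : q' = q
    · subst hq; simp; omega
    · simp [hq]
  refine ⟨⟨h.dec, h.ext, h.nodup, ?_, ?_, ?_, ?_⟩, hE⟩
  · intro j' x hx
    by_cases hq : x.1 = q
    · left
      simp only [hq, Function.update_self]
      rcases h.tag j' x hx with h7 | h7
      · rw [hq] at h7; omega
      · rw [hq, ← hpq, hl] at h7
        rcases not_mid h7 with ⟨_, _, h8⟩ | ⟨_, _, _, h8⟩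
        · simp at h8
        · simp only [Loc.wrP.injEq] at h8; omega
    · have : G.pid x.1 ≠ p := by
        intro h8; rw [hpq] at h8; exact hq (G.pid_inj h8)
      simpa [hq, this] using h.tag j' x hx
  · intro q'
    by_cases hq : q' = q
    · subst hq
      simp only [Function.update_self]
      exact ⟨h5, h6⟩
    · simp only [Function.update_of_ne hq]
      exact h.posH q'
  · intro j' hj' h0
    obtain ⟨q', hq'⟩ := h.lead j' hj' h0
    exact ⟨q', hq'.trans (hE.pos_le q')⟩
  · intro p' op' l' hl'
    by_cases hp : p' = p
    · subst hp
      simp only [Function.update_self, Option.some.injEq, Prod.mk.injEq] at hl'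
      obtain ⟨rfl, rfl⟩ := hl'
      exact hy
    · simp only [Function.update_of_ne hp] at hl'
      refine LI_frame (h.loc p' op' l' hl') hE ?_
      intro q' hq'
      have : q' ≠ q := by
        rintro rfl; exact hp ((G.own_pid _ _ _ hq').trans hpq.symm)
      exact ⟨by simp [this], rfl⟩

theorem GInv_step {G : Par P HOp HRes} {s s' : AS P HOp G.k} {D : ℕ} {e : Ev P HOp HRes}
    (h : GInv G s D) (hs : AStep G s e s') : ∃ D', GInv G s' D' ∧ Ext s D s' D' := by
  cases hs with
  | inv p op hl =>
    refine ⟨D, GInv_loc h p _ ?_ ?_, Ext_loc _ _ _⟩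
    · rintro op' l' h'
      simp only [Option.some.injEq, Prod.mk.injEq] at h'
      obtain ⟨rfl, rfl⟩ := h'
      unfold Par.start
      split
      · rename_i q hq; exact hq
      · rename_i hq
        exact ⟨Nat.zero_le _, rfl, by simp, fun _ => hq, by simp⟩
    · rintro q j ⟨op', n, r, h' | ⟨_, h'⟩⟩ <;> rw [hl] at h' <;> simp at h'
  | rd0 p op q hl =>
    refine ⟨D, GInv_loc h p _ ?_ ?_, Ext_loc _ _ _⟩
    · rintro op' l' h'
      simp only [Option.some.injEq, Prod.mk.injEq] at h'
      obtain ⟨rfl, rfl⟩ := h'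
      exact ⟨h.loc _ _ _ hl, rfl⟩
    · intro q j hM
      rw [hl] at hM
      rcases not_mid hM with ⟨_, _, h8⟩ | ⟨_, _, _, h8⟩ <;> simp at h8
  | wr0 p op q n hl =>
    obtain ⟨h1, h2⟩ := h.loc _ _ _ hl
    have hpq := G.own_pid _ _ _ h1
    have hE : Ext s D { s with
          ann := Function.update s.ann q ⟨n + 1, [], some op⟩
          loc := Function.update s.loc p (some (op, .colM (some (q, n + 1)) 0 0 [])) } D := by
      refine ⟨le_rfl, fun j _ => by cases j <;> rfl, fun _ => le_rfl, ?_⟩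
      intro q'
      by_cases hq : q' = q
      · subst hq; simp; omega
      · simp [hq]
    refine ⟨D, ⟨h.dec, h.ext, h.nodup, ?_, h.posH, h.lead, ?_⟩, hE⟩
    · intro j' x hx
      refine (h.tag j' x hx).imp id ?_
      intro hM
      by_cases hp : G.pid x.1 = p
      · rw [hp, hl] at hM
        rcases not_mid hM with ⟨_, _, h8⟩ | ⟨_, _, _, h8⟩ <;> simp at h8
      · simpa [hp] using hM
    · intro p' op' l' hl'
      by_cases hp : p' = p
      · subst hp
        simp only [Function.update_self, Option.some.injEq, Prod.mk.injEq] at hl'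
        obtain ⟨rfl, rfl⟩ := hl'
        refine ⟨Nat.zero_le _, rfl, by simp, by simp, ?_⟩
        intro q' n' hm
        simp only [Option.some.injEq, Prod.mk.injEq] at hm
        obtain ⟨rfl, rfl⟩ := hm
        exact ⟨h1, by simp, by simp, by simp⟩
      · simp only [Function.update_of_ne hp] at hl'
        refine LI_frame (h.loc p' op' l' hl') hE ?_
        intro q' hq'
        have : q' ≠ q := by
          rintro rfl; exact hp ((G.own_pid _ _ _ hq').trans hpq.symm)
        exact ⟨rfl, by simp [this]⟩
  | colM1 p op md i j hh q hl hi hj =>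
    obtain ⟨h1, h2, h3, h4, h5⟩ := h.loc _ _ _ hl
    refine ⟨D, GInv_loc h p _ ?_ ?_, Ext_loc _ _ _⟩
    · rintro op' l' h'
      simp only [Option.some.injEq, Prod.mk.injEq] at h'
      obtain ⟨rfl, rfl⟩ := h'
      refine ⟨(h.posH q).1, (h.posH q).2, fun _ => ⟨q, le_rfl⟩, h4, ?_⟩
      intro q' n' hm
      obtain ⟨a, b, c, d⟩ := h5 q' n' hm
      refine ⟨a, b, c, fun hlt => ?_⟩
      by_cases hqq : q' = q
      · rw [hqq]
      · have : q'.val ≠ q.val := fun h => hqq (Fin.ext h)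
        exact (d (by omega)).trans hj
    · intro q j hM
      rw [hl] at hM
      rcases not_mid hM with ⟨_, _, h8⟩ | ⟨_, _, _, h8⟩ <;> simp at h8
  | colM2 p op md i j hh q hl hi hj =>
    obtain ⟨h1, h2, h3, h4, h5⟩ := h.loc _ _ _ hl
    refine ⟨D, GInv_loc h p _ ?_ ?_, Ext_loc _ _ _⟩
    · rintro op' l' h'
      simp only [Option.some.injEq, Prod.mk.injEq] at h'
      obtain ⟨rfl, rfl⟩ := h'
      refine ⟨h1, h2, h3, h4, ?_⟩
      intro q' n' hm
      obtain ⟨a, b, c, d⟩ := h5 q' n' hm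
      refine ⟨a, b, c, fun hlt => ?_⟩
      by_cases hqq : q' = q
      · rw [hqq]; exact hj.le
      · have : q'.val ≠ q.val := fun h => hqq (Fin.ext h)
        exact (d (by omega))
    · intro q j hM
      rw [hl] at hM
      rcases not_mid hM with ⟨_, _, h8⟩ | ⟨_, _, _, h8⟩ <;> simp at h8
  | colM3 p op i j hh hl hi =>
    obtain ⟨h1, h2, h3, h4, h5⟩ := h.loc _ _ _ hl
    refine ⟨D, GInv_loc h p _ ?_ ?_, Ext_loc _ _ _⟩
    · rintro op' l' h'
      simp only [Option.some.injEq, Prod.mk.injEq] at h'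
      obtain ⟨rfl, rfl⟩ := h'
      refine ⟨h4 rfl, ?_⟩
      by_cases hS : s.S j = []
      · exact ⟨j, h1, by rw [hS]; exact h2⟩
      · refine ⟨j + 1, (h.dec j).1 hS, ?_⟩
        change headH hh (s.S j) = headH [] (s.S j)
        revert hS
        generalize s.S j = L
        intro hS
        cases L with
        | nil => exact absurd rfl hS
        | cons a l => rfl
    · intro q j hM
      rw [hl] at hM
      rcases not_mid hM with ⟨_, _, h8⟩ | ⟨_, _, _, h8⟩ <;> simp at h8
  | colM4 p op q n i j hh hl hi =>
    obtain ⟨h1, h2, h3, h4, h5⟩ := h.loc _ _ _ hl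
    obtain ⟨a, b, c, d⟩ := h5 q n rfl
    refine ⟨D, GInv_loc h p _ ?_ ?_, Ext_loc _ _ _⟩
    · rintro op' l' h'
      simp only [Option.some.injEq, Prod.mk.injEq] at h'
      obtain ⟨rfl, rfl⟩ := h'
      exact ⟨a, b, c, d (lt_of_lt_of_le q.2 hi), h1, by rw [h2], h3⟩
    · intro q j hM
      rw [hl] at hM
      rcases not_mid hM with ⟨_, _, h8⟩ | ⟨_, _, _, h8⟩ <;> simp at h8
  | colA1 p op q n r j i acc q' hl hi =>
    obtain ⟨h1, h2, h3, h4, h5, h6, h7⟩ := h.loc _ _ _ hl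
    refine ⟨D, GInv_loc h p _ ?_ ?_, Ext_loc _ _ _⟩
    · rintro op' l' h'
      simp only [Option.some.injEq, Prod.mk.injEq] at h'
      obtain ⟨rfl, rfl⟩ := h'
      exact ⟨h1, h2, h3, h4, h5, h6.trans (addE_prefix _ _ _), h7⟩
    · intro q j hM
      rw [hl] at hM
      rcases not_mid hM with ⟨_, _, h8⟩ | ⟨_, _, _, h8⟩ <;> simp at h8
  | colA2 p op q n r j i acc hl hi =>
    obtain ⟨h1, h2, h3, h4, h5, h6, h7⟩ := h.loc _ _ _ hl
    have hpq := G.own_pid _ _ _ h1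
    have hnot : q ∉ (s.S j).map Prod.fst := by
      intro hm
      obtain ⟨x, hx, rfl⟩ := List.mem_map.1 hm
      rcases h.tag j x hx with h8 | h8
      · omega
      · rw [← hpq, hl] at h8
        rcases not_mid h8 with ⟨_, _, h8⟩ | ⟨_, _, _, h8⟩ <;> simp at h8
    have hlen : (s.S j).length + 1 ≤ G.k := by
      have := List.Nodup.length_le_card (l := q :: (s.S j).map Prod.fst)
        (List.nodup_cons.2 ⟨hnot, h.nodup j⟩)
      simpa using this
    rw [Nat.sub_eq_zero_of_le hlen, List.drop_zero]
    set s' : AS P HOp G.k := { s with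
          S := Function.update s.S j (s.S j ++ [(q, acc)])
          loc := Function.update s.loc p (some (op, .rdS q n r j)) } with hs'
    have hSj : s'.S j = s.S j ++ [(q, acc)] := by simp [hs']
    have hSn : ∀ j', j' ≠ j → s'.S j' = s.S j' := by intro j' hj'; simp [hs', hj']
    have hH : ∀ j', j' ≤ D → Hs s' j' = Hs s j' := by
      intro j' hj'
      cases j' with
      | zero => rfl
      | succ j' =>
        simp only [Hs]
        by_cases hjj : j' = j
        · subst hjj
          rw [hSj, headH_append _ _ _ ((h.dec j').2 hj')]
        · rw [hSn _ hjj]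
    have hE : Ext s D s' (max D (j + 1)) := ⟨le_max_left _ _, hH, fun _ => le_rfl, fun _ => le_rfl⟩
    refine ⟨max D (j + 1), ⟨?_, ?_, ?_, ?_, ?_, ?_, ?_⟩, hE⟩
    · intro j'
      by_cases hjj : j' = j
      · subst hjj; rw [hSj]; simp
      · rw [hSn _ hjj, h.dec j']; omega
    · intro j' x hx
      have hle : j' ≤ D := by
        by_cases hjj : j' = j
        · omega
        · rw [hSn _ hjj] at hx
          exact ((h.dec j').1 (List.ne_nil_of_mem hx)).le
      rw [hH j' hle]
      by_cases hjj : j' = j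
      · subst hjj
        rw [hSj, List.mem_append] at hx
        rcases hx with hx | hx
        · exact h.ext _ x hx
        · simp only [List.mem_singleton] at hx; subst hx; exact h6
      · rw [hSn _ hjj] at hx; exact h.ext _ x hx
    · intro j'
      by_cases hjj : j' = j
      · subst hjj
        rw [hSj, List.map_append, List.nodup_append]
        refine ⟨h.nodup _, by simp, ?_⟩
        intro a ha b hb
        simp only [List.map_cons, List.map_nil, List.mem_singleton] at hb
        subst hb
        rintro rfl
        exact hnot ha
      · rw [hSn _ hjj]; exact h.nodup _
    · intro j' x hx
      have hold : x ∈ s.S j' ∨ (j' = j ∧ x = (q, acc)) := by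
        by_cases hjj : j' = j
        · subst hjj
          rw [hSj, List.mem_append] at hx
          simpa using hx
        · rw [hSn _ hjj] at hx; exact Or.inl hx
      rcases hold with hx | ⟨rfl, rfl⟩
      · refine (h.tag j' x hx).imp id ?_
        intro hM
        by_cases hp : G.pid x.1 = p
        · rw [hp, hl] at hM
          rcases not_mid hM with ⟨_, _, h8⟩ | ⟨_, _, _, h8⟩ <;> simp at h8
        · simpa [hs', hp] using hM
      · right
        refine ⟨op, n, r, Or.inl ?_⟩
        rw [← hpq]; simp [hs']
    · intro q'
      refine ⟨(h.posH q').1.trans (le_max_left _ _), ?_⟩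
      change (s.pos q').hist = Hs s' (s.pos q').num
      rw [hH _ (h.posH q').1]
      exact (h.posH q').2
    · intro j' hj' h0
      by_cases hlt : j' < D
      · exact h.lead j' hlt h0
      · have : j' = j := by omega
        subst this
        exact h7 h0
    · intro p' op' l' hl'
      by_cases hp : p' = p
      · subst hp
        simp only [hs', Function.update_self, Option.some.injEq, Prod.mk.injEq] at hl'
        obtain ⟨rfl, rfl⟩ := hl'
        exact ⟨h1, h2, h3, h4, by omega⟩
      · simp only [hs', Function.update_of_ne hp] at hl'
        exact LI_frame (h.loc p' op' l' hl') hE fun _ _ => ⟨rfl, rfl⟩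
  | rdS p op q n r j hl =>
    obtain ⟨h1, h2, h3, h4, h5⟩ := h.loc _ _ _ hl
    refine ⟨D, GInv_loc h p _ ?_ ?_, Ext_loc _ _ _⟩
    · rintro op' l' h'
      simp only [Option.some.injEq, Prod.mk.injEq] at h'
      obtain ⟨rfl, rfl⟩ := h'
      exact ⟨h1, h2, h3, h4, h5, rfl⟩
    · intro q' j' hM
      rw [hl] at hM
      rcases not_mid hM with ⟨_, _, h8⟩ | ⟨_, _, _, h8⟩
      · simp only [Loc.rdS.injEq] at h8
        obtain ⟨rfl, -, -, rfl⟩ := h8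
        exact ⟨op, n, r, Or.inr ⟨_, rfl⟩⟩
      · simp at h8
  | wrP1 p op q n r j hh hl hr =>
    obtain ⟨h1, h2, h3, h4, h5, h6⟩ := h.loc _ _ _ hl
    refine ⟨D, GInv_pos h p hl _ ?_⟩
    refine ⟨h1, h2, h3, by simp, h5, ?_, fun _ => ⟨q, by simp⟩⟩
    rw [h6]; exact List.prefix_rfl
  | wrP2 p op q n r j hh hl hr =>
    obtain ⟨h1, h2, h3, h4, h5, h6⟩ := h.loc _ _ _ hl
    exact ⟨D, GInv_pos h p hl _ ⟨h1, h2, h3, j + 1, h5, h6⟩⟩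
  | ret1 p op q n hh hl =>
    refine ⟨D, GInv_loc h p _ (by simp) ?_, Ext_loc _ _ _⟩
    intro q j hM
    rw [hl] at hM
    rcases not_mid hM with ⟨_, _, h8⟩ | ⟨_, _, _, h8⟩ <;> simp at h8
  | ret2 p op hh hl =>
    refine ⟨D, GInv_loc h p _ (by simp) ?_, Ext_loc _ _ _⟩
    intro q j hM
    rw [hl] at hM
    rcases not_mid hM with ⟨_, _, h8⟩ | ⟨_, _, _, h8⟩ <;> simp at h8


/-- Initial abstract state. -/
def AS.init0 (P HOp : Type) (k : ℕ) : AS P HOp k :=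
  ⟨fun _ => [], fun _ => ⟨0, [], none⟩, fun _ => ⟨0, [], none⟩, fun _ => none⟩

/-- Abstract runs. -/
structure ARun (G : Par P HOp HRes) where
  len : ℕ
  s : ℕ → AS P HOp G.k
  D : ℕ → ℕ
  ev : ℕ → Ev P HOp HRes
  s0 : s 0 = AS.init0 P HOp G.k
  step : ∀ t, t < len → AStep G (s t) (ev t) (s (t + 1))
  inv : ∀ t, t ≤ len → GInv G (s t) (D t)
  ext : ∀ t t', t ≤ t' → t' ≤ len → Ext (s t) (D t) (s t') (D t')

theorem GInv_init (G : Par P HOp HRes) : GInv G (AS.init0 P HOp G.k) 0 where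
  dec := by simp [AS.init0]
  ext := by simp [AS.init0]
  nodup := by simp [AS.init0]
  tag := by simp [AS.init0]
  posH := by simp [AS.init0, Hs]
  lead := by simp
  loc := by simp [AS.init0]

theorem GInv_unique {G : Par P HOp HRes} {s : AS P HOp G.k} {D D' : ℕ} (h : GInv G s D)
    (h' : GInv G s D') : D = D' := by
  by_contra hne
  rcases Nat.lt_or_gt_of_ne hne with hlt | hlt
  · exact absurd ((h.dec D).1 ((h'.dec D).2 hlt)) (lt_irrefl _)
  · exact absurd ((h'.dec D').1 ((h.dec D').2 hlt)) (lt_irrefl _)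

theorem exists_ARun (G : Par P HOp HRes) (R : Run G.impl) :
    ∃ A : ARun G, A.len = R.len ∧ A.ev = R.ev := by
  classical
  let s : ℕ → AS P HOp G.k := fun t => absC G (R.cfg t)
  have hs0 : s 0 = AS.init0 P HOp G.k := by
    simp only [s, R.h0]
    rfl
  have hst : ∀ t, t < R.len → AStep G (s t) (R.ev t) (s (t + 1)) :=
    fun t ht => absC_step G _ _ _ (R.hstep t ht)
  have hex : ∀ t, t ≤ R.len → ∃ D, GInv G (s t) D := by
    intro t
    induction t with
    | zero => intro _; exact ⟨0, by rw [hs0]; exact GInv_init G⟩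
    | succ t ih =>
      intro ht
      obtain ⟨D, hD⟩ := ih (by omega)
      obtain ⟨D', hD', _⟩ := GInv_step hD (hst t (by omega))
      exact ⟨D', hD'⟩
  let D : ℕ → ℕ := fun t => if h : ∃ D, GInv G (s t) D then h.choose else 0
  have hD : ∀ t, t ≤ R.len → GInv G (s t) (D t) := by
    intro t ht
    have := hex t ht
    simp only [D, dif_pos this]
    exact this.choose_spec
  refine ⟨⟨R.len, s, D, R.ev, hs0, hst, hD, ?_⟩, rfl, rfl⟩
  intro t t' htt
  induction t', htt using Nat.le_induction with
  | base => intro _; exact Ext.refl _ _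
  | succ u hu ih =>
    intro hl
    refine (ih (by omega)).trans ?_
    obtain ⟨D', h1, h2⟩ := GInv_step (hD u (by omega)) (hst u (by omega))
    rwa [GInv_unique (hD (u + 1) hl) h1]

theorem Hs_succ {G : Par P HOp HRes} {s : AS P HOp G.k} {D : ℕ} (h : GInv G s D) {j : ℕ}
    (hj : j < D) : ∃ x ∈ s.S j, Hs s (j + 1) = x.2 :=
  headH_mem [] (s.S j) ((h.dec j).2 hj)

theorem Hs_mono {G : Par P HOp HRes} {s : AS P HOp G.k} {D : ℕ} (h : GInv G s D) {j j' : ℕ}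
    (hj : j ≤ j') (hD : j' ≤ D) : Hs s j <+: Hs s j' := by
  induction j', hj using Nat.le_induction with
  | base => exact List.prefix_rfl
  | succ u hu ih =>
    refine (ih (by omega)).trans ?_
    obtain ⟨x, hx, he⟩ := Hs_succ h (Nat.lt_of_succ_le hD)
    rw [he]
    exact h.ext u x hx

/-- How announcements change. -/
theorem AStep.ann_cases {G : Par P HOp HRes} {s s' : AS P HOp G.k} {e : Ev P HOp HRes}
    (h : AStep G s e s') (q : Fin G.k) : s'.ann q = s.ann q ∨
      ∃ p op n, e = .step p ∧ s.loc p = some (op, .wr0 q n) ∧ s'.ann q = ⟨n + 1, [], some op⟩ := by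
  cases h with
  | wr0 p op q' n hl =>
    by_cases hq : q = q'
    · subst hq
      exact Or.inr ⟨p, op, n, rfl, hl, by simp⟩
    · left; simp [hq]
  | _ => exact Or.inl rfl

/-- How sliding registers change. -/
theorem AStep.S_cases {G : Par P HOp HRes} {s s' : AS P HOp G.k} {e : Ev P HOp HRes}
    (h : AStep G s e s') (j : ℕ) (x) (hx : x ∈ s'.S j) : x ∈ s.S j ∨
      ∃ p op n r i, s.loc p = some (op, .colA x.1 n r j i x.2) ∧ G.k ≤ i := by
  cases h with
  | colA2 p op q n r j' i acc hl hi =>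
    by_cases hq : j = j'
    · subst hq
      simp only [Function.update_self] at hx
      have := List.mem_of_mem_drop hx
      simp only [List.mem_append, List.mem_singleton] at this
      rcases this with h1 | h1
      · exact Or.inl h1
      · subst h1
        exact Or.inr ⟨p, op, n, r, i, hl, hi⟩
    · left; simpa [hq] using hx
  | _ => exact Or.inl hx

/-- How collected histories change. -/
theorem AStep.acc_cases {G : Par P HOp HRes} {s s' : AS P HOp G.k} {D : ℕ} {e : Ev P HOp HRes}
    (hI : GInv G s D) (h : AStep G s e s') (p op q n r j i acc)
    (hx : s'.loc p = some (op, .colA q n r j i acc)) :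
      s.loc p = some (op, .colA q n r j i acc) ∨
      (i = 0 ∧ j ≤ D ∧ acc = Hs s j) ∨
      ∃ (q' : Fin G.k) (acc0 : _), i = q'.val + 1 ∧ s.loc p = some (op, .colA q n r j q' acc0) ∧
        acc = addE acc0 q' (s.ann q') := by
  have key : ∀ (p' : P) (y : Option (HOp × Loc G.k HOp)),
      s'.loc = Function.update s.loc p' y →
      (y = some (op, .colA q n r j i acc) → p = p' → (i = 0 ∧ j ≤ D ∧ acc = Hs s j) ∨
      ∃ (q' : Fin G.k) (acc0 : _), i = q'.val + 1 ∧ s.loc p = some (op, .colA q n r j q' acc0) ∧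
        acc = addE acc0 q' (s.ann q')) → (s.loc p = some (op, .colA q n r j i acc) ∨
      (i = 0 ∧ j ≤ D ∧ acc = Hs s j) ∨
      ∃ (q' : Fin G.k) (acc0 : _), i = q'.val + 1 ∧ s.loc p = some (op, .colA q n r j q' acc0) ∧
        acc = addE acc0 q' (s.ann q')) := by
    intro p' y e1 e2
    rw [e1] at hx
    by_cases hp : p = p'
    · subst hp
      rw [Function.update_self] at hx
      exact Or.inr (e2 hx rfl)
    · rw [Function.update_of_ne hp] at hx
      exact Or.inl hx
  cases h with
  | colM4 p' op q n i j h hl hi =>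
    refine key _ _ rfl ?_
    intro e1 e2
    obtain ⟨h1, h2, _⟩ := hI.loc _ _ _ hl
    cases e1
    exact Or.inl ⟨rfl, h1, h2⟩
  | wrP1 p' op q n r j h hl hr =>
    refine key _ _ rfl ?_
    intro e1 e2
    obtain ⟨h1, h2, h3, h4, h5, h6⟩ := hI.loc _ _ _ hl
    cases e1
    exact Or.inl ⟨rfl, h5, h6⟩
  | colA1 p' op q n r j i acc q' hl hi =>
    refine key _ _ rfl ?_
    intro e1 e2
    subst e2
    cases e1
    subst hi
    exact Or.inr ⟨q', acc, rfl, hl, rfl⟩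
  | inv p' op' hl =>
    refine key _ _ rfl ?_
    intro e1 e2
    unfold Par.start at e1
    split at e1 <;> simp at e1
  | _ => refine key _ _ rfl ?_; intro e1; simp at e1

theorem AStep.step_loc {G : Par P HOp HRes} {s s' : AS P HOp G.k} {p : P}
    (h : AStep G s (.step p) s') : ∃ op l l', s.loc p = some (op, l) ∧
      s'.loc = Function.update s.loc p (some (op, l')) := by
  cases h <;> exact ⟨_, _, _, ‹s.loc p = some _›, rfl⟩

theorem AStep.ret_loc {G : Par P HOp HRes} {s s' : AS P HOp G.k} {p : P} {r : HRes}
    (h : AStep G s (.ret p r) s') : ∃ op l, s.loc p = some (op, l) ∧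
      s' = { s with loc := Function.update s.loc p none } := by
  cases h <;> exact ⟨_, _, ‹s.loc p = some _›, rfl⟩

theorem AStep.inv_loc {G : Par P HOp HRes} {s s' : AS P HOp G.k} {p : P} {op : HOp}
    (h : AStep G s (.inv p op) s') : s.loc p = none ∧
      s' = { s with loc := Function.update s.loc p (some (op, G.start p op)) } := by
  cases h
  exact ⟨‹_›, rfl⟩

/-- Who moves. -/
theorem AStep.loc_cases {G : Par P HOp HRes} {s s' : AS P HOp G.k} {e : Ev P HOp HRes}
    (h : AStep G s e s') (p : P) (op : HOp) (l' : Loc G.k HOp) (hx : s'.loc p = some (op, l')) :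
    (e = .inv p op ∧ s.loc p = none ∧ l' = G.start p op) ∨
    (∃ l, s.loc p = some (op, l) ∧ (∀ op', e ≠ .inv p op') ∧ ∀ r, e ≠ .ret p r) := by
  cases e with
  | inv p' op' =>
    obtain ⟨h1, rfl⟩ := h.inv_loc
    by_cases hp : p = p'
    · subst hp
      simp only [Function.update_self, Option.some.injEq, Prod.mk.injEq] at hx
      obtain ⟨rfl, rfl⟩ := hx
      exact Or.inl ⟨rfl, h1, rfl⟩
    · simp only [Function.update_of_ne hp] at hx
      refine Or.inr ⟨l', hx, ?_, by simp⟩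
      intro op'' h'
      cases h'
      exact hp rfl
  | step p' =>
    obtain ⟨o, l, l2, h1, h2⟩ := h.step_loc
    rw [h2] at hx
    refine Or.inr ?_
    by_cases hp : p = p'
    · subst hp
      simp only [Function.update_self, Option.some.injEq, Prod.mk.injEq] at hx
      obtain ⟨rfl, rfl⟩ := hx
      exact ⟨l, h1, by simp, by simp⟩
    · simp only [Function.update_of_ne hp] at hx
      exact ⟨l', hx, by simp, by simp⟩
  | ret p' r =>
    obtain ⟨o, l, h1, rfl⟩ := h.ret_loc
    by_cases hp : p = p'
    · subst hp
      simp at hx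
    · simp only [Function.update_of_ne hp] at hx
      refine Or.inr ⟨l', hx, by simp, ?_⟩
      intro op'' h'
      cases h'
      exact hp rfl

/-- Pending and not yet announced. -/
def pend {k : ℕ} : Option (HOp × Loc k HOp) → ℕ
  | some (_, .rd0 _) => 1
  | some (_, .wr0 _ _) => 1
  | _ => 0

/-- Invocation of an update of `q`. -/
def isInv (G : Par P HOp HRes) (q : Fin G.k) (e : Ev P HOp HRes) : Prop :=
  ∃ p op, e = .inv p op ∧ G.own p op = some q

open Classical in
theorem pend_step {G : Par P HOp HRes} {s s' : AS P HOp G.k} {D : ℕ} {e : Ev P HOp HRes}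
    (hI : GInv G s D) (h : AStep G s e s') (q : Fin G.k) :
    (s'.ann q).num + pend (s'.loc (G.pid q)) =
      (s.ann q).num + pend (s.loc (G.pid q)) + if isInv G q e then 1 else 0 := by
  have hn : ∀ p, ¬ isInv G q (.step p : Ev P HOp HRes) := by
    rintro p ⟨_, _, h, _⟩; cases h
  have hn' : ∀ p r, ¬ isInv G q (.ret p r : Ev P HOp HRes) := by
    rintro p r ⟨_, _, h, _⟩; cases h
  have key : ∀ (p : P) (y : Option (HOp × Loc G.k HOp)), s'.ann = s.ann →
      s'.loc = Function.update s.loc p y → pend y = pend (s.loc p) →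
      (s'.ann q).num + pend (s'.loc (G.pid q)) = (s.ann q).num + pend (s.loc (G.pid q)) + 0 := by
    intro p y e1 e2 e3
    rw [e1, e2]
    by_cases hp : G.pid q = p
    · subst hp; simp [e3]
    · simp [hp]
  cases h with
  | inv p op hl =>
    by_cases hp : G.pid q = p
    · subst hp
      simp only [Function.update_self, hl]
      unfold Par.start
      cases ho : G.own (G.pid q) op with
      | none =>
        rw [if_neg]
        · simp [pend]
        · rintro ⟨_, _, h1, h2⟩; cases h1; rw [ho] at h2; cases h2
      | some q' =>
        have : q = q' := G.pid_inj (G.own_pid _ _ _ ho)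
        subst this
        rw [if_pos ⟨_, _, rfl, ho⟩]
        simp [pend]
    · simp only [Function.update_of_ne hp]
      have : ¬ isInv G q (.inv p op : Ev P HOp HRes) := by
        rintro ⟨_, _, h1, h2⟩
        cases h1
        exact hp (G.own_pid _ _ _ h2).symm
      rw [if_neg this, add_zero]
  | wr0 p op q' n hl =>
    rw [if_neg (hn _)]
    obtain ⟨h1, h2⟩ := hI.loc _ _ _ hl
    have h3 := G.own_pid _ _ _ h1
    by_cases hp : q = q'
    · subst hp
      subst h3
      simp [hl, h2, pend]
    · have : G.pid q ≠ p := by rw [h3]; exact fun h => hp (G.pid_inj h)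
      simp [hp, this]
  | ret1 p op q' n h hl =>
    rw [if_neg (hn' _ _)]
    exact key p _ rfl rfl (by rw [hl]; rfl)
  | ret2 p op h hl =>
    rw [if_neg (hn' _ _)]
    exact key p _ rfl rfl (by rw [hl]; rfl)
  | _ =>
    rw [if_neg (hn _)]
    refine key _ _ rfl rfl ?_
    simp only [*, pend]

namespace ARun

variable {G : Par P HOp HRes} (A : ARun G)

open Classical in
/-- Number of update invocations of `q` before `t`. -/
noncomputable def cnt (q : Fin G.k) (t : ℕ) : ℕ :=
  ((Finset.range t).filter fun u => isInv G q (A.ev u)).card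

open Classical in
theorem cnt_succ (q : Fin G.k) (t : ℕ) :
    A.cnt q (t + 1) = A.cnt q t + if isInv G q (A.ev t) then 1 else 0 := by
  unfold cnt
  rw [Finset.range_add_one, Finset.filter_insert]
  split
  · rw [Finset.card_insert_of_notMem (by simp)]
  · rfl

theorem cnt_mono (q : Fin G.k) {t t' : ℕ} (h : t ≤ t') : A.cnt q t ≤ A.cnt q t' := by
  unfold cnt
  gcongr

theorem cnt_lt (q : Fin G.k) {t t' : ℕ} (h : t < t') (hi : isInv G q (A.ev t)) :
    A.cnt q t + 1 ≤ A.cnt q t' := by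
  have := A.cnt_succ q t
  rw [if_pos hi] at this
  rw [← this]
  exact A.cnt_mono q h

theorem cnt_eq (q : Fin G.k) (t : ℕ) (ht : t ≤ A.len) :
    A.cnt q t = ((A.s t).ann q).num + pend ((A.s t).loc (G.pid q)) := by
  classical
  induction t with
  | zero => rw [A.s0]; simp [cnt, AS.init0, pend]
  | succ t ih =>
    rw [pend_step (A.inv t (by omega)) (A.step t ht) q, ← ih (by omega), cnt_succ]

/-- The entry `e` comes from an invocation before `t`. -/
def Valid (t : ℕ) (e : Entry G.k HOp) : Prop :=
  ∃ t' < t, A.ev t' = .inv (G.pid e.q) e.op ∧ G.own (G.pid e.q) e.op = some e.q ∧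
    A.cnt e.q t' + 1 = e.n

theorem Valid.mono {A : ARun G} {t t' : ℕ} {e : Entry G.k HOp} (h : A.Valid t e) (ht : t ≤ t') :
    A.Valid t' e := by
  obtain ⟨u, h1, h2⟩ := h
  exact ⟨u, by omega, h2⟩

theorem pending (t : ℕ) (ht : t ≤ A.len) (p : P) (op : HOp) (l : Loc G.k HOp)
    (hl : (A.s t).loc p = some (op, l)) (q : Fin G.k) (hq : G.own p op = some q) :
    ∃ t' < t, A.ev t' = .inv p op ∧ A.cnt q t = A.cnt q t' + 1 := by
  classical
  induction t generalizing l with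
  | zero => rw [A.s0] at hl; simp [AS.init0] at hl
  | succ t ih =>
    have hs := A.step t ht
    rcases hs.loc_cases p op l hl with ⟨h1, h2, h3⟩ | ⟨l0, h1, h2, h3⟩
    · exact ⟨t, by omega, h1, by rw [cnt_succ, if_pos ⟨p, op, h1, hq⟩]⟩
    · obtain ⟨t', ht', h4, h5⟩ := ih (by omega) l0 h1
      refine ⟨t', by omega, h4, ?_⟩
      rw [cnt_succ, if_neg, h5]
      rintro ⟨p', op', h6, h7⟩
      have : p' = p := by rw [G.own_pid _ _ _ h7, G.own_pid _ _ _ hq]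
      subst this
      exact h2 _ h6

theorem annV (t : ℕ) (ht : t ≤ A.len) (q : Fin G.k) (o : HOp)
    (h : ((A.s t).ann q).op = some o) : A.Valid t ⟨q, ((A.s t).ann q).num, o⟩ := by
  induction t with
  | zero => rw [A.s0] at h; simp [AS.init0] at h
  | succ t ih =>
    rcases (A.step t ht).ann_cases q with h1 | ⟨p, op, n, h1, h2, h3⟩
    · rw [h1] at h ⊢
      exact (ih (by omega) h).mono (by omega)
    · rw [h3] at h ⊢
      cases h
      obtain ⟨h4, h5⟩ := (A.inv t (by omega)).loc _ _ _ h2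
      have hp := G.own_pid _ _ _ h4
      subst hp
      obtain ⟨t', h6, h7, h8⟩ := A.pending t (by omega) _ _ _ h2 q h4
      refine ⟨t', by omega, h7, h4, ?_⟩
      have := A.cnt_eq q t (by omega)
      rw [h2] at this
      simp only [pend] at this
      simp only
      omega

/-- Well-formed histories. -/
def Good (t : ℕ) (h : List (Entry G.k HOp)) : Prop :=
  (∀ e ∈ h, A.Valid t e) ∧ (h.map Entry.key).Nodup

theorem Good.mono {A : ARun G} {t t' : ℕ} {h : List (Entry G.k HOp)} (hg : A.Good t h)
    (ht : t ≤ t') : A.Good t' h :=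
  ⟨fun e he => (hg.1 e he).mono ht, hg.2⟩

theorem good (t : ℕ) (ht : t ≤ A.len) :
    (∀ j x, x ∈ (A.s t).S j → A.Good t x.2) ∧
    (∀ p op q n r j i acc, (A.s t).loc p = some (op, .colA q n r j i acc) → A.Good t acc) := by
  induction t with
  | zero => rw [A.s0]; simp [AS.init0]
  | succ t ih =>
    obtain ⟨ih1, ih2⟩ := ih (by omega)
    have hs := A.step t ht
    have hI := A.inv t (by omega)
    constructor
    · intro j x hx
      rcases hs.S_cases j x hx with h1 | ⟨p, op, n, r, i, h1, h2⟩
      · exact (ih1 j x h1).mono (by omega)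
      · exact (ih2 _ _ _ _ _ _ _ _ h1).mono (by omega)
    · intro p op q n r j i acc hx
      rcases hs.acc_cases hI p op q n r j i acc hx with h1 | ⟨_, h1, h2⟩ | ⟨q', acc0, h1, h2, h3⟩
      · exact (ih2 _ _ _ _ _ _ _ _ h1).mono (by omega)
      · cases j with
        | zero => rw [h2]; exact ⟨by simp [Hs], by simp [Hs]⟩
        | succ j =>
          obtain ⟨x, hx, he⟩ := Hs_succ hI h1
          rw [h2, he]
          exact (ih1 j x hx).mono (by omega)
      · have hg := (ih2 _ _ _ _ _ _ _ _ h2).mono (Nat.le_succ t)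
        rw [h3]
        unfold addE
        split
        · exact hg
        · rename_i o ho
          split
          · exact hg
          · rename_i hk
            constructor
            · intro e he
              simp only [List.mem_append, List.mem_singleton] at he
              rcases he with he | he
              · exact hg.1 e he
              · rw [he]; exact (A.annV t (by omega) q' o ho).mono (by omega)
            · rw [List.map_append, List.nodup_append]
              refine ⟨hg.2, by simp, ?_⟩
              intro a ha b hb hab
              simp only [List.map_cons, List.map_nil, List.mem_singleton] at hb
              subst hab
              subst hb
              exact hk ha

theorem good_Hs (t : ℕ) (ht : t ≤ A.len) (j : ℕ) (hj : j ≤ A.D t) : A.Good t (Hs (A.s t) j) := by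
  cases j with
  | zero => exact ⟨by simp [Hs], by simp [Hs]⟩
  | succ j =>
    obtain ⟨x, hx, he⟩ := Hs_succ (A.inv t ht) hj
    rw [he]
    exact (A.good t ht).1 j x hx

/-- Helping: an announced operation is included in later slots. -/
theorem help (ta t : ℕ) (hta : ta ≤ t) (ht : t ≤ A.len) (q : Fin G.k) (o : HOp) (n : ℕ)
    (h : (A.s ta).ann q = ⟨n, [], some o⟩) (hn : ((A.s t).ann q).num = n) :
    (A.s t).ann q = ⟨n, [], some o⟩ ∧
    (∀ j x, A.D ta < j → x ∈ (A.s t).S j → (q, n) ∈ x.2.map Entry.key) ∧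
    (∀ p op q' n' r j i acc, A.D ta < j → (A.s t).loc p = some (op, .colA q' n' r j i acc) →
      q.val < i → (q, n) ∈ acc.map Entry.key) := by
  induction t, hta using Nat.le_induction with
  | base =>
    have hI := A.inv ta ht
    refine ⟨h, ?_, ?_⟩
    · intro j x hj hx
      have := (hI.dec j).1 (List.ne_nil_of_mem hx)
      omega
    · intro p op q' n' r j i acc hj hl _
      obtain ⟨_, _, _, _, h5, _⟩ := hI.loc _ _ _ hl
      omega
  | succ t hta ih =>
    have hI := A.inv t (by omega)
    have e1 : ((A.s t).ann q).num = n := by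
      have h1 := (A.ext t (t + 1) (by omega) ht).ann_le q
      have h2 := (A.ext ta t hta (by omega)).ann_le q
      rw [h] at h2
      simp only at h2
      omega
    obtain ⟨ih1, ih2, ih3⟩ := ih (by omega) e1
    have hs := A.step t ht
    refine ⟨?_, ?_, ?_⟩
    · rcases hs.ann_cases q with h1 | ⟨p, op, n', h1, h2, h3⟩
      · rw [h1, ih1]
      · exfalso
        obtain ⟨h4, h5⟩ := hI.loc _ _ _ h2
        rw [h3] at hn
        simp only at hn
        omega
    · intro j x hj hx
      rcases hs.S_cases j x hx with h1 | ⟨p, op, n, r, i, h1, h2⟩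
      · exact ih2 j x hj h1
      · exact ih3 _ _ _ _ _ _ _ _ hj h1 (lt_of_lt_of_le q.2 h2)
    · intro p op q' n' r j i acc hj hx hqi
      rcases hs.acc_cases hI _ _ _ _ _ _ _ _ hx with h1 | ⟨h1, _⟩ | ⟨q2, acc0, h1, h2, h3⟩
      · exact ih3 _ _ _ _ _ _ _ _ hj h1 hqi
      · omega
      · by_cases hq : q = q2
        · subst hq
          rw [h3, ih1]
          unfold addE
          simp only
          split
          · assumption
          · simp [Entry.key]
        · have : q.val ≠ q2.val := fun h => hq (Fin.ext h)
          have := ih3 _ _ _ _ _ _ _ _ hj h2 (by omega)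
          rw [h3]
          exact ((addE_prefix acc0 q2 _).map _).subset this

end ARun

/-- Bound on the number of remaining steps. -/
def rank {k : ℕ} : Loc k HOp → ℕ
  | .rd0 _ => 4 * k + 12
  | .wr0 _ _ => 4 * k + 11
  | .colM _ i _ _ => (k - i) + 1 + 3 * k + 9
  | .colA _ _ r _ i _ => (2 - r) * (k + 3) + (k - i) + 3
  | .rdS _ _ r _ => (2 - r) * (k + 3) + 2
  | .wrP _ _ r _ _ => (2 - r) * (k + 3) + 1
  | .done _ _ _ => 0
  | .doneRO _ => 0

theorem rank_step {G : Par P HOp HRes} {s s' : AS P HOp G.k} {p : P} {op op' : HOp}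
    {l l' : Loc G.k HOp} (h : AStep G s (.step p) s') (hl : s.loc p = some (op, l))
    (hl' : s'.loc p = some (op', l')) : rank l' + 1 ≤ rank l := by
  revert hl hl'
  cases h <;>
  · have h0 := ‹s.loc p = some _›
    intro hl hl'
    rw [h0] at hl
    simp only [Function.update_self, Option.some.injEq, Prod.mk.injEq] at hl hl'
    obtain ⟨rfl, rfl⟩ := hl
    obtain ⟨rfl, rfl⟩ := hl'
    simp only [rank]
    first
    | omega
    | (rename_i r j hh ha hb
       obtain rfl | rfl : r = 0 ∨ r = 1 := by omega
       all_goals omega)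

theorem AStep.frame {G : Par P HOp HRes} {s s' : AS P HOp G.k} {e : Ev P HOp HRes}
    (h : AStep G s e s') (p : P) (h1 : ∀ op, e ≠ .inv p op) (h2 : e ≠ .step p)
    (h3 : ∀ r, e ≠ .ret p r) : s'.loc p = s.loc p := by
  cases e with
  | inv p' op' =>
    obtain ⟨_, rfl⟩ := h.inv_loc
    have hp : p ≠ p' := by rintro rfl; exact h1 _ rfl
    simp [hp]
  | step p' =>
    obtain ⟨o, l, l2, _, h5⟩ := h.step_loc
    have hp : p ≠ p' := by rintro rfl; exact h2 rfl
    simp [hp, h5]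
  | ret p' r =>
    obtain ⟨o, l, _, rfl⟩ := h.ret_loc
    have hp : p ≠ p' := by rintro rfl; exact h3 _ rfl
    simp [hp]

namespace ARun

variable {G : Par P HOp HRes} (A : ARun G)

/-- Relation between a pending operation and the state at its invocation. -/
def Rel (t0 t : ℕ) : Loc G.k HOp → Prop
  | .rd0 _ => True
  | .wr0 _ _ => True
  | .colM none i j _ => ∀ q' : Fin G.k, q'.val < i → ((A.s t0).pos q').num ≤ j
  | .colM (some (q, n)) i j _ => ∃ ta o, t0 ≤ ta ∧ ta ≤ t ∧ (A.s ta).ann q = ⟨n, [], some o⟩ ∧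
      ∀ q' : Fin G.k, q'.val < i → ((A.s ta).pos q').num ≤ j
  | .colA q n r j _ _ => ∃ ta o, t0 ≤ ta ∧ ta ≤ t ∧ (A.s ta).ann q = ⟨n, [], some o⟩ ∧
      A.D ta + r ≤ j + 1
  | .rdS q n r j => ∃ ta o, t0 ≤ ta ∧ ta ≤ t ∧ (A.s ta).ann q = ⟨n, [], some o⟩ ∧
      A.D ta + r ≤ j + 1
  | .wrP q n r j h => (∃ ta o, t0 ≤ ta ∧ ta ≤ t ∧ (A.s ta).ann q = ⟨n, [], some o⟩ ∧
      A.D ta + r ≤ j + 1) ∧ (2 ≤ r → (q, n) ∈ h.map Entry.key)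
  | .done q n h => (q, n) ∈ h.map Entry.key
  | .doneRO h => ∃ j, A.D t0 ≤ j ∧ j ≤ A.D t ∧ h = Hs (A.s t) j

theorem Rel.mono {A : ARun G} {t0 t t' : ℕ} (ht : t ≤ t') (ht' : t' ≤ A.len) {l : Loc G.k HOp}
    (h : A.Rel t0 t l) : A.Rel t0 t' l := by
  cases l with
  | rd0 q => trivial
  | wr0 q n => trivial
  | colM md i j hh =>
    cases md with
    | none => exact h
    | some x =>
      obtain ⟨ta, o, h1, h2, h3⟩ := h
      exact ⟨ta, o, h1, by omega, h3⟩
  | colA q n r j i acc =>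
    obtain ⟨ta, o, h1, h2, h3⟩ := h
    exact ⟨ta, o, h1, by omega, h3⟩
  | rdS q n r j =>
    obtain ⟨ta, o, h1, h2, h3⟩ := h
    exact ⟨ta, o, h1, by omega, h3⟩
  | wrP q n r j hh =>
    obtain ⟨⟨ta, o, h1, h2, h3⟩, h4⟩ := h
    exact ⟨⟨ta, o, h1, by omega, h3⟩, h4⟩
  | done q n hh => exact h
  | doneRO hh =>
    obtain ⟨j, h1, h2, h3⟩ := h
    have hE := A.ext t t' ht ht'
    exact ⟨j, h1, h2.trans hE.D_le, by rw [hE.H_eq j h2]; exact h3⟩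

theorem D_le_of_pos (t : ℕ) (ht : t ≤ A.len) (j : ℕ)
    (h : ∀ q' : Fin G.k, ((A.s t).pos q').num ≤ j) : A.D t ≤ j + 1 := by
  by_contra hc
  obtain ⟨q, hq⟩ := (A.inv t ht).lead (j + 1) (by omega) (by omega)
  have := h q
  omega

theorem rel_step {t0 t : ℕ} (ht0 : t0 ≤ t) (ht : t < A.len) {p : P} {op op' : HOp}
    {l l' : Loc G.k HOp} (he : A.ev t = .step p) (hl : (A.s t).loc p = some (op, l))
    (hl' : (A.s (t + 1)).loc p = some (op', l')) (h : A.Rel t0 t l) : A.Rel t0 (t + 1) l' := by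
  have hs := A.step t ht
  rw [he] at hs
  have hI := A.inv t ht.le
  have hE := A.ext t (t + 1) (by omega) ht
  refine Rel.mono (t := t + 1) le_rfl ht ?_
  have hI' := A.inv (t + 1) ht
  generalize hs' : A.s (t + 1) = s' at *
  cases hs with
  | rd0 _ op q h0 =>
    rw [h0] at hl
    simp only [Function.update_self, Option.some.injEq, Prod.mk.injEq] at hl hl'
    obtain ⟨rfl, rfl⟩ := hl
    obtain ⟨rfl, rfl⟩ := hl'
    trivial
  | wr0 _ op q n h0 =>
    rw [h0] at hl
    simp only [Function.update_self, Option.some.injEq, Prod.mk.injEq] at hl hl'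
    obtain ⟨rfl, rfl⟩ := hl
    obtain ⟨rfl, rfl⟩ := hl'
    exact ⟨t + 1, op, by omega, le_rfl, by rw [hs']; simp, by simp⟩
  | colM1 _ op md i j hh q h0 hi hj =>
    rw [h0] at hl
    simp only [Function.update_self, Option.some.injEq, Prod.mk.injEq] at hl hl'
    obtain ⟨rfl, rfl⟩ := hl
    obtain ⟨rfl, rfl⟩ := hl'
    cases md with
    | none =>
      intro q' hq'
      by_cases hq : q' = q
      · subst hq; exact (A.ext t0 t ht0 ht.le).pos_le q'
      · have : q'.val ≠ q.val := fun h => hq (Fin.ext h)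
        exact (h q' (by omega)).trans hj
    | some x =>
      obtain ⟨ta, o, h1, h2, h3, h4⟩ := h
      refine ⟨ta, o, h1, by omega, h3, ?_⟩
      intro q' hq'
      by_cases hq : q' = q
      · subst hq; exact (A.ext ta t h2 ht.le).pos_le q'
      · have : q'.val ≠ q.val := fun h => hq (Fin.ext h)
        exact (h4 q' (by omega)).trans hj
  | colM2 _ op md i j hh q h0 hi hj =>
    rw [h0] at hl
    simp only [Function.update_self, Option.some.injEq, Prod.mk.injEq] at hl hl'
    obtain ⟨rfl, rfl⟩ := hl
    obtain ⟨rfl, rfl⟩ := hl'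
    cases md with
    | none =>
      intro q' hq'
      by_cases hq : q' = q
      · subst hq; exact ((A.ext t0 t ht0 ht.le).pos_le q').trans hj.le
      · have : q'.val ≠ q.val := fun h => hq (Fin.ext h)
        exact (h q' (by omega))
    | some x =>
      obtain ⟨ta, o, h1, h2, h3, h4⟩ := h
      refine ⟨ta, o, h1, by omega, h3, ?_⟩
      intro q' hq'
      by_cases hq : q' = q
      · subst hq; exact ((A.ext ta t h2 ht.le).pos_le q').trans hj.le
      · have : q'.val ≠ q.val := fun h => hq (Fin.ext h)
        exact (h4 q' (by omega))
  | colM3 _ op i j hh h0 hi =>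
    obtain ⟨a1, a2, a3, a4, a5⟩ := hI.loc _ _ _ h0
    rw [h0] at hl
    simp only [Function.update_self, Option.some.injEq, Prod.mk.injEq] at hl hl'
    obtain ⟨rfl, rfl⟩ := hl
    obtain ⟨rfl, rfl⟩ := hl'
    have hD := A.D_le_of_pos t0 (by omega) j (fun q' => h q' (lt_of_lt_of_le q'.2 hi))
    have hDt := (A.ext t0 t ht0 ht.le).D_le
    refine Rel.mono (Nat.le_succ t) ht ?_
    by_cases hS : (A.s t).S j = []
    · have : ¬ j < A.D t := fun h => (hI.dec j).2 h hS
      exact ⟨j, by omega, a1, by rw [hS]; exact a2⟩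
    · refine ⟨j + 1, hD, (hI.dec j).1 hS, ?_⟩
      change headH hh ((A.s t).S j) = headH [] ((A.s t).S j)
      revert hS
      generalize (A.s t).S j = L
      intro hS
      cases L with
      | nil => exact absurd rfl hS
      | cons a l => rfl
  | colM4 _ op q n i j hh h0 hi =>
    rw [h0] at hl
    simp only [Function.update_self, Option.some.injEq, Prod.mk.injEq] at hl hl'
    obtain ⟨rfl, rfl⟩ := hl
    obtain ⟨rfl, rfl⟩ := hl'
    obtain ⟨ta, o, h1, h2, h3, h4⟩ := h
    exact ⟨ta, o, h1, by omega, h3,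
      A.D_le_of_pos ta (by omega) j (fun q' => h4 q' (lt_of_lt_of_le q'.2 hi))⟩
  | colA1 _ op q n r j i acc q' h0 hi =>
    rw [h0] at hl
    simp only [Function.update_self, Option.some.injEq, Prod.mk.injEq] at hl hl'
    obtain ⟨rfl, rfl⟩ := hl
    obtain ⟨rfl, rfl⟩ := hl'
    obtain ⟨ta, o, h1, h2, h3⟩ := h
    exact ⟨ta, o, h1, by omega, h3⟩
  | colA2 _ op q n r j i acc h0 hi =>
    rw [h0] at hl
    simp only [Function.update_self, Option.some.injEq, Prod.mk.injEq] at hl hl'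
    obtain ⟨rfl, rfl⟩ := hl
    obtain ⟨rfl, rfl⟩ := hl'
    obtain ⟨ta, o, h1, h2, h3⟩ := h
    exact ⟨ta, o, h1, by omega, h3⟩
  | rdS _ op q n r j h0 =>
    obtain ⟨a1, a2, a3, a4, a5⟩ := hI.loc _ _ _ h0
    rw [h0] at hl
    simp only [Function.update_self, Option.some.injEq, Prod.mk.injEq] at hl hl'
    obtain ⟨rfl, rfl⟩ := hl
    obtain ⟨rfl, rfl⟩ := hl'
    obtain ⟨ta, o, h1, h2, h3, h4⟩ := h
    refine ⟨⟨ta, o, h1, by omega, h3, h4⟩, ?_⟩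
    intro hr
    obtain ⟨x, hx, hxe⟩ := headH_mem [] ((A.s t).S j) ((hI.dec j).2 a5)
    rw [hxe]
    exact (A.help ta t h2 ht.le q o n h3 (by rw [a2])).2.1 j x (by omega) hx
  | wrP1 _ op q n r j hh h0 hr =>
    rw [h0] at hl
    simp only [Function.update_self, Option.some.injEq, Prod.mk.injEq] at hl hl'
    obtain ⟨rfl, rfl⟩ := hl
    obtain ⟨rfl, rfl⟩ := hl'
    obtain ⟨⟨ta, o, h1, h2, h3, h4⟩, h5⟩ := h
    exact ⟨ta, o, h1, by omega, h3, by omega⟩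
  | wrP2 _ op q n r j hh h0 hr =>
    rw [h0] at hl
    simp only [Function.update_self, Option.some.injEq, Prod.mk.injEq] at hl hl'
    obtain ⟨rfl, rfl⟩ := hl
    obtain ⟨rfl, rfl⟩ := hl'
    exact h.2 hr

/-- Main lemma on pending operations. -/
theorem main_rel {t0 : ℕ} (p : P) (o : HOp) (he : A.ev t0 = .inv p o) (t : ℕ) (ht0 : t0 < t)
    (ht : t ≤ A.len) (hr : ∀ u r, t0 < u → u < t → A.ev u ≠ .ret p r) :
    ∃ l, (A.s t).loc p = some (o, l) ∧ A.Rel t0 t l ∧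
      ((Finset.Ioo t0 t).filter fun u => (A.ev u).isStepOf p).card + rank l ≤ 4 * G.k + 12 := by
  induction t, ht0 using Nat.le_induction with
  | base =>
    have hs := A.step t0 ht
    rw [he] at hs
    obtain ⟨h1, h2⟩ := hs.inv_loc
    refine ⟨G.start p o, by rw [h2]; simp, ?_, ?_⟩
    · unfold Par.start
      split
      · trivial
      · intro q' hq'; omega
    · have : Finset.Ioo t0 (t0 + 1) = ∅ := by ext x; simp
      rw [this]
      unfold Par.start
      split <;> simp [rank]
      omega
  | succ t ht0 ih =>
    obtain ⟨l, h1, h2, h3⟩ := ih (by omega) (fun u r a b => hr u r a (by omega))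
    have hs := A.step t ht
    have hIoo : Finset.Ioo t0 (t + 1) = insert t (Finset.Ioo t0 t) := by
      ext x; simp; omega
    rw [hIoo, Finset.filter_insert]
    by_cases hst : A.ev t = .step p
    · rw [hst] at hs
      obtain ⟨op, l1, l2, h5, h6⟩ := hs.step_loc
      rw [h1] at h5
      simp only [Option.some.injEq, Prod.mk.injEq] at h5
      obtain ⟨rfl, rfl⟩ := h5
      have h7 : (A.s (t + 1)).loc p = some (o, l2) := by rw [h6]; simp
      refine ⟨l2, h7, A.rel_step (by omega) ht hst h1 h7 h2, ?_⟩
      have := rank_step hs h1 h7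
      rw [if_pos (by rw [hst]; simp [Ev.isStepOf]), Finset.card_insert_of_notMem (by simp)]
      omega
    · have h4 : (A.s (t + 1)).loc p = (A.s t).loc p := by
        refine hs.frame p ?_ hst ?_
        · intro op h5
          rw [h5] at hs
          rw [hs.inv_loc.1] at h1
          cases h1
        · intro r h5
          exact hr t r (by omega) (by omega) h5
      refine ⟨l, by rw [h4]; exact h1, h2.mono (by omega) ht, ?_⟩
      rw [if_neg]
      · exact h3
      · cases h5 : A.ev t with
        | step p' =>
          simp only [Ev.isStepOf, decide_eq_true_eq]
          rintro rfl
          exact hst h5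
        | _ => simp [Ev.isStepOf]

end ARun

section Lin

variable {I : Type} {mem : I → ObjType} [DecidableEq I]

theorem MatchedRet.unique {impl : Impl P HOp HRes I mem} {R : Run impl} {t tr tr' : ℕ} {p : P}
    {r r' : HRes} (h : MatchedRet R t tr p r) (h' : MatchedRet R t tr' p r') :
    tr = tr' ∧ r = r' := by
  obtain ⟨h1, h2, h3⟩ := h
  obtain ⟨h1', h2', h3'⟩ := h'
  have : tr = tr' := by
    by_contra hne
    rcases Nat.lt_or_gt_of_ne hne with hlt | hlt
    · exact h3' tr r h1 hlt h2
    · exact h3 tr' r' h1' hlt h2'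
  subst this
  have := h2.2.symm.trans h2'.2
  cases this
  exact ⟨rfl, rfl⟩

theorem InvAt.unique {impl : Impl P HOp HRes I mem} {R : Run impl} {t : ℕ} {p p' : P}
    {o o' : HOp} (h : InvAt R t p o) (h' : InvAt R t p' o') : p = p' ∧ o = o' := by
  have := h.2.symm.trans h'.2
  cases this
  exact ⟨rfl, rfl⟩

/-- State after a sequential history. -/
def runS (spec : SeqSpec P HOp HRes) (s : spec.St) (L : List (P × HOp × HRes)) : spec.St :=
  L.foldl (fun s x => (spec.δ s x.1 x.2.1).1) s

theorem SeqConsistent_append (spec : SeqSpec P HOp HRes) (s : spec.St)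
    (L L' : List (P × HOp × HRes)) (h : SeqConsistent spec s L)
    (h' : SeqConsistent spec (runS spec s L) L') : SeqConsistent spec s (L ++ L') := by
  induction L generalizing s with
  | nil => exact h'
  | cons x L ih =>
    obtain ⟨p, o, r⟩ := x
    exact ⟨h.1, ih _ h.2 h'⟩

theorem SeqConsistent_ro (G : Par P HOp HRes) (s : G.spec.St) (L : List (P × HOp × HRes))
    (h : ∀ x ∈ L, G.own x.1 x.2.1 = none ∧ (G.spec.δ s x.1 x.2.1).2 = x.2.2) :
    SeqConsistent G.spec s L ∧ runS G.spec s L = s := by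
  induction L with
  | nil => exact ⟨trivial, rfl⟩
  | cons x L ih =>
    obtain ⟨p, o, r⟩ := x
    obtain ⟨h1, h2⟩ := h _ List.mem_cons_self
    have h3 := G.own_none p o h1 s
    obtain ⟨h4, h5⟩ := ih fun x hx => h x (List.mem_cons_of_mem _ hx)
    simp only at h2
    refine ⟨⟨h2, by rw [h3]; exact h4⟩, ?_⟩
    simp only [runS, List.foldl_cons, h3]
    exact h5

/-- Read-only operations linearized at position `i`. -/
noncomputable def blk (G : Par P HOp HRes) {impl : Impl P HOp HRes I mem} (R : Run impl)
    (F : List (Entry G.k HOp)) (po : ℕ → ℕ) (i : ℕ) : List (ℕ × ℕ × P × HOp × HRes) :=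
  open Classical in
  (List.range R.len).filterMap fun t =>
    match R.ev t with
    | .inv p o =>
      if G.own p o = none ∧ (∃ tr r, MatchedRet R t tr p r) ∧ po t = i then
        some (2 * i, t, p, o, (G.spec.δ (G.st (F.take i)) p o).2)
      else none
    | _ => none

theorem mem_blk {G : Par P HOp HRes} {impl : Impl P HOp HRes I mem} {R : Run impl}
    {F : List (Entry G.k HOp)} {po : ℕ → ℕ} {i : ℕ} {x : ℕ × ℕ × P × HOp × HRes} :
    x ∈ blk G R F po i ↔ ∃ t p o tr r, InvAt R t p o ∧ G.own p o = none ∧ MatchedRet R t tr p r ∧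
      po t = i ∧ x = (2 * i, t, p, o, (G.spec.δ (G.st (F.take i)) p o).2) := by
  unfold blk
  simp only [List.mem_filterMap, List.mem_range]
  constructor
  · rintro ⟨t, ht, h⟩
    split at h
    · rename_i p o he
      split at h
      · rename_i hc
        obtain ⟨h1, ⟨tr, r, h2⟩, h3⟩ := hc
        cases h
        exact ⟨t, p, o, tr, r, ⟨ht, he⟩, h1, h2, h3, rfl⟩
      · cases h
    · cases h
  · rintro ⟨t, p, o, tr, r, h1, h2, h3, h4, rfl⟩
    refine ⟨t, h1.1, ?_⟩
    rw [h1.2]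
    simp only
    rw [if_pos ⟨h2, ⟨tr, r, h3⟩, h4⟩]

/-- Lexicographic order. -/
def LexR (x y : ℕ × ℕ × P × HOp × HRes) : Prop := x.1 < y.1 ∨ (x.1 = y.1 ∧ x.2.1 < y.2.1)

theorem blk_pairwise (G : Par P HOp HRes) {impl : Impl P HOp HRes I mem} (R : Run impl)
    (F : List (Entry G.k HOp)) (po : ℕ → ℕ) (i : ℕ) : (blk G R F po i).Pairwise LexR := by
  classical
  unfold blk
  rw [List.pairwise_filterMap]
  refine List.Pairwise.imp ?_ (List.pairwise_lt_range (n := R.len))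
  intro t t' htt b hb b' hb'
  split at hb
  · split at hb
    · cases hb
      split at hb'
      · split at hb'
        · cases hb'
          exact Or.inr ⟨rfl, htt⟩
        · cases hb'
      · cases hb'
    · cases hb
  · cases hb

/-- The update linearized at position `i`. -/
def seg (G : Par P HOp HRes) (F : List (Entry G.k HOp)) (et : ℕ → ℕ) (i : ℕ) :
    List (ℕ × ℕ × P × HOp × HRes) :=
  match F[i]? with
  | some e => [(2 * i + 1, et i, G.pid e.q, e.op, (G.spec.δ (G.st (F.take i)) (G.pid e.q) e.op).2)]
  | none => []

/-- The linearization. -/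
noncomputable def linT (G : Par P HOp HRes) {impl : Impl P HOp HRes I mem} (R : Run impl)
    (F : List (Entry G.k HOp)) (po et : ℕ → ℕ) : ℕ → List (ℕ × ℕ × P × HOp × HRes)
  | 0 => blk G R F po 0
  | i + 1 => linT G R F po et i ++ (seg G F et i ++ blk G R F po (i + 1))

theorem mem_linT {G : Par P HOp HRes} {impl : Impl P HOp HRes I mem} {R : Run impl}
    {F : List (Entry G.k HOp)} {po et : ℕ → ℕ} {i : ℕ} {x : ℕ × ℕ × P × HOp × HRes} :
    x ∈ linT G R F po et i ↔ (∃ m ≤ i, x ∈ blk G R F po m) ∨ ∃ m < i, x ∈ seg G F et m := by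
  induction i with
  | zero => simp [linT]
  | succ i ih =>
    simp only [linT, List.mem_append, ih]
    constructor
    · rintro ((⟨m, h1, h2⟩ | ⟨m, h1, h2⟩) | h | h)
      · exact Or.inl ⟨m, by omega, h2⟩
      · exact Or.inr ⟨m, by omega, h2⟩
      · exact Or.inr ⟨i, by omega, h⟩
      · exact Or.inl ⟨i + 1, by omega, h⟩
    · rintro (⟨m, h1, h2⟩ | ⟨m, h1, h2⟩)
      · by_cases hm : m = i + 1
        · subst hm; exact Or.inr (Or.inr h2)
        · exact Or.inl (Or.inl ⟨m, by omega, h2⟩)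
      · by_cases hm : m = i
        · subst hm; exact Or.inr (Or.inl h2)
        · exact Or.inl (Or.inr ⟨m, by omega, h2⟩)

theorem blk_fst {G : Par P HOp HRes} {impl : Impl P HOp HRes I mem} {R : Run impl}
    {F : List (Entry G.k HOp)} {po : ℕ → ℕ} {i : ℕ} {x : ℕ × ℕ × P × HOp × HRes}
    (h : x ∈ blk G R F po i) : x.1 = 2 * i := by
  obtain ⟨t, p, o, tr, r, _, _, _, _, rfl⟩ := mem_blk.1 h
  rfl

theorem mem_seg {G : Par P HOp HRes}
    {F : List (Entry G.k HOp)} {et : ℕ → ℕ} {i : ℕ} {x : ℕ × ℕ × P × HOp × HRes} :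
    x ∈ seg G F et i ↔ ∃ hi : i < F.length, x = (2 * i + 1, et i, G.pid F[i].q, F[i].op,
      (G.spec.δ (G.st (F.take i)) (G.pid F[i].q) F[i].op).2) := by
  unfold seg
  by_cases hi : i < F.length
  · rw [List.getElem?_eq_getElem hi]
    simp [hi]
  · rw [List.getElem?_eq_none (by omega)]
    simp [hi]

theorem linT_pairwise (G : Par P HOp HRes) {impl : Impl P HOp HRes I mem} (R : Run impl)
    (F : List (Entry G.k HOp)) (po et : ℕ → ℕ) (i : ℕ) :
    (linT G R F po et i).Pairwise LexR := by
  induction i with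
  | zero => exact blk_pairwise _ _ _ _ _
  | succ i ih =>
    simp only [linT, List.pairwise_append]
    refine ⟨ih, ⟨?_, blk_pairwise _ _ _ _ _, ?_⟩, ?_⟩
    · unfold seg
      split <;> simp
    · intro a ha b hb
      obtain ⟨hi, rfl⟩ := mem_seg.1 ha
      have := blk_fst hb
      left
      simp only
      omega
    · intro a ha b hb
      have h1 : a.1 ≤ 2 * i := by
        rcases mem_linT.1 ha with ⟨m, hm, h⟩ | ⟨m, hm, h⟩
        · rw [blk_fst h]; omega
        · obtain ⟨_, rfl⟩ := mem_seg.1 h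
          simp only
          omega
      have h2 : 2 * i < b.1 := by
        rcases List.mem_append.1 hb with h | h
        · obtain ⟨_, rfl⟩ := mem_seg.1 h
          simp
        · rw [blk_fst h]; omega
      left
      omega

theorem linT_consistent (G : Par P HOp HRes) {impl : Impl P HOp HRes I mem} (R : Run impl)
    (F : List (Entry G.k HOp)) (po et : ℕ → ℕ) (i : ℕ) (hi : i ≤ F.length) :
    SeqConsistent G.spec G.spec.init ((linT G R F po et i).map fun x => x.2.2) ∧
    runS G.spec G.spec.init ((linT G R F po et i).map fun x => x.2.2) = G.st (F.take i) := by
  have hb : ∀ i, SeqConsistent G.spec (G.st (F.take i)) ((blk G R F po i).map fun x => x.2.2) ∧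
      runS G.spec (G.st (F.take i)) ((blk G R F po i).map fun x => x.2.2) = G.st (F.take i) := by
    intro i
    refine SeqConsistent_ro G _ _ ?_
    intro x hx
    obtain ⟨y, hy, rfl⟩ := List.mem_map.1 hx
    obtain ⟨t, p, o, tr, r, _, h, _, _, rfl⟩ := mem_blk.1 hy
    exact ⟨h, rfl⟩
  induction i with
  | zero => exact hb 0
  | succ i ih =>
    obtain ⟨h1, h2⟩ := ih (by omega)
    obtain ⟨h3, h4⟩ := hb (i + 1)
    have hsg : seg G F et i = [(2 * i + 1, et i, G.pid F[i].q, F[i].op,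
      (G.spec.δ (G.st (F.take i)) (G.pid F[i].q) F[i].op).2)] := by
      unfold seg
      rw [List.getElem?_eq_getElem hi]
    have hst : G.st (F.take (i + 1)) =
        (G.spec.δ (G.st (F.take i)) (G.pid F[i].q) F[i].op).1 := by
      rw [List.take_succ_eq_append_getElem hi]
      unfold Par.st
      rw [List.foldl_append]
      rfl
    simp only [linT, hsg, List.map_append, List.map_cons, List.map_nil]
    constructor
    · refine SeqConsistent_append _ _ _ _ h1 ?_
      rw [h2]
      exact ⟨rfl, by rw [← hst]; exact h3⟩
    · unfold runS at h2 h4 ⊢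
      rw [List.foldl_append, h2, List.singleton_append, List.foldl_cons]
      simp only
      rw [← hst, h4]

theorem lin_core (G : Par P HOp HRes) {impl : Impl P HOp HRes I mem} (R : Run impl)
    (F : List (Entry G.k HOp)) (c et : ℕ → ℕ) (hc : ∀ t t', t ≤ t' → t' ≤ R.len → c t ≤ c t')
    (hcN : ∀ t, t ≤ R.len → c t ≤ F.length)
    (hE : ∀ i (hi : i < F.length), InvAt R (et i) (G.pid F[i].q) F[i].op ∧
      G.own (G.pid F[i].q) F[i].op ≠ none)
    (hE1 : ∀ i t, t ≤ R.len → i < c t → et i < t)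
    (hE2 : ∀ i i', i < F.length → i' < F.length → et i = et i' → i = i')
    (hE3 : ∀ t p o tr r, InvAt R t p o → G.own p o ≠ none → MatchedRet R t tr p r →
      ∃ i < c tr, et i = t ∧ r = (G.spec.δ (G.st (F.take i)) p o).2)
    (hR : ∀ t p o tr r, InvAt R t p o → G.own p o = none → MatchedRet R t tr p r →
      ∃ m, c t ≤ m ∧ m ≤ c tr ∧ r = (G.spec.δ (G.st (F.take m)) p o).2) :
    IsLin G.spec R := by
  classical
  have hpo : ∀ t, ∃ m, ∀ p o tr r, InvAt R t p o → G.own p o = none → MatchedRet R t tr p r →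
      c t ≤ m ∧ m ≤ c tr ∧ r = (G.spec.δ (G.st (F.take m)) p o).2 := by
    intro t
    by_cases h : ∃ p o tr r, InvAt R t p o ∧ G.own p o = none ∧ MatchedRet R t tr p r
    · obtain ⟨p, o, tr, r, h1, h2, h3⟩ := h
      obtain ⟨m, hm⟩ := hR t p o tr r h1 h2 h3
      refine ⟨m, ?_⟩
      intro p' o' tr' r' h1' h2' h3'
      obtain ⟨rfl, rfl⟩ := h1.unique h1'
      obtain ⟨rfl, rfl⟩ := h3.unique h3'
      exact hm
    · refine ⟨0, ?_⟩
      intro p o tr r h1 h2 h3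
      exact absurd ⟨p, o, tr, r, h1, h2, h3⟩ h
  choose po hpo using hpo
  have hlt : ∀ {t tr : ℕ} {p : P} {r : HRes}, MatchedRet R t tr p r → tr < R.len :=
    fun h => h.2.1.1
  set N := F.length with hN
  set T := linT G R F po et N with hT
  have hpw : T.Pairwise LexR := linT_pairwise G R F po et N
  have hco := (linT_consistent G R F po et N le_rfl).1
  have memT : ∀ x, x ∈ T ↔ (∃ m ≤ N, x ∈ blk G R F po m) ∨ ∃ m < N, x ∈ seg G F et m :=
    fun x => mem_linT
  -- membership facts
  have hinv : ∀ x ∈ T, InvAt R x.2.1 x.2.2.1 x.2.2.2.1 := by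
    intro x hx
    rcases (memT x).1 hx with ⟨m, hm, h⟩ | ⟨m, hm, h⟩
    · obtain ⟨t, p, o, tr, r, h1, _, _, _, rfl⟩ := mem_blk.1 h
      exact h1
    · obtain ⟨hi, rfl⟩ := mem_seg.1 h
      exact (hE m hi).1
  have hw : ∀ x ∈ T, ∀ y ∈ T, x.2.1 = y.2.1 → x.1 = y.1 := by
    intro x hx y hy hxy
    have ix := hinv x hx
    have iy := hinv y hy
    rw [hxy] at ix
    obtain ⟨e1, e2⟩ := ix.unique iy
    rcases (memT x).1 hx with ⟨m, hm, h⟩ | ⟨m, hm, h⟩ <;>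
    rcases (memT y).1 hy with ⟨m', hm', h'⟩ | ⟨m', hm', h'⟩
    · obtain ⟨t, p, o, tr, r, h1, h2, h3, h4, rfl⟩ := mem_blk.1 h
      obtain ⟨t', p', o', tr', r', h1', h2', h3', h4', rfl⟩ := mem_blk.1 h'
      simp only at hxy
      subst hxy
      simp only
      omega
    · obtain ⟨t, p, o, tr, r, h1, h2, h3, h4, rfl⟩ := mem_blk.1 h
      obtain ⟨hi, rfl⟩ := mem_seg.1 h'
      simp only at e1 e2
      rw [e1, e2] at h2
      exact absurd h2 (hE m' hi).2
    · obtain ⟨t, p, o, tr, r, h1, h2, h3, h4, rfl⟩ := mem_blk.1 h'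
      obtain ⟨hi, rfl⟩ := mem_seg.1 h
      simp only at e1 e2
      rw [← e1, ← e2] at h2
      exact absurd h2 (hE m hi).2
    · obtain ⟨hi, rfl⟩ := mem_seg.1 h
      obtain ⟨hi', rfl⟩ := mem_seg.1 h'
      simp only at hxy
      have := hE2 m m' hi hi' hxy
      simp only
      omega
  -- bounds for completed operations
  have hup : ∀ x ∈ T, ∀ tr r, MatchedRet R x.2.1 tr x.2.2.1 r →
      x.1 ≤ 2 * c tr ∧ x.2.2.2.2 = r := by
    intro x hx tr r hm
    rcases (memT x).1 hx with ⟨m, _, h⟩ | ⟨m, _, h⟩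
    · obtain ⟨t, p, o, tr', r', h1, h2, h3, h4, rfl⟩ := mem_blk.1 h
      obtain ⟨g1, g2, g3⟩ := hpo t p o tr r h1 h2 hm
      subst h4
      exact ⟨by simp only; omega, g3.symm⟩
    · obtain ⟨hi, rfl⟩ := mem_seg.1 h
      obtain ⟨i, g1, g2, g3⟩ := hE3 _ _ _ _ _ (hE m hi).1 (hE m hi).2 hm
      have : i = m := hE2 i m (lt_of_lt_of_le g1 (hcN tr (hlt hm).le)) hi g2
      subst this
      exact ⟨by simp only; omega, g3.symm⟩
  have hlow : ∀ x ∈ T, ∀ tr, tr < x.2.1 → 2 * c tr ≤ x.1 := by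
    intro x hx tr htr
    have hl := (hinv x hx).1
    rcases (memT x).1 hx with ⟨m, _, h⟩ | ⟨m, _, h⟩
    · obtain ⟨t, p, o, tr', r', h1, h2, h3, h4, rfl⟩ := mem_blk.1 h
      obtain ⟨g1, g2, g3⟩ := hpo t p o tr' r' h1 h2 h3
      have := hc tr t htr.le hl.le
      simp only
      omega
    · obtain ⟨hi, rfl⟩ := mem_seg.1 h
      simp only at htr hl ⊢
      by_contra hcon
      have := hE1 m tr (by omega) (by omega)
      omega
  have hlen : (T.map fun x => x.2.2).length = T.length := List.length_map ..
  have hget : ∀ k : Fin (T.map fun x => x.2.2).length,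
      (T.map fun x => x.2.2).get k = (T.get (k.cast hlen)).2.2 := by
    intro k
    simp
  have hmem : ∀ k : Fin (T.map fun x => x.2.2).length, T.get (k.cast hlen) ∈ T :=
    fun k => List.get_mem _ _
  have hlex : ∀ k k' : Fin (T.map fun x => x.2.2).length, k < k' →
      LexR (T.get (k.cast hlen)) (T.get (k'.cast hlen)) := by
    intro k k' hk
    exact List.pairwise_iff_get.1 hpw _ _ hk
  refine ⟨T.map fun x => x.2.2, fun k => (T.get (k.cast hlen)).2.1, hco, ?_, ?_, ?_, ?_, ?_⟩
  · intro k k' hk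
    simp only at hk
    have h1 := hw _ (hmem k) _ (hmem k') hk
    rcases lt_trichotomy k k' with h | h | h
    · have := hlex _ _ h
      unfold LexR at this
      omega
    · exact h
    · have := hlex _ _ h
      unfold LexR at this
      omega
  · intro k
    rw [hget]
    exact hinv _ (hmem k)
  · intro t p o tr r h1 h2
    have hx : ∃ x ∈ T, x.2.1 = t ∧ x.2.2 = (p, o, r) := by
      by_cases ho : G.own p o = none
      · obtain ⟨g1, g2, g3⟩ := hpo t p o tr r h1 ho h2
        refine ⟨(2 * po t, t, p, o, r), (memT _).2 (Or.inl ⟨po t, g2.trans (hcN tr (hlt h2).le),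
          mem_blk.2 ⟨t, p, o, tr, r, h1, ho, h2, rfl, ?_⟩⟩), rfl, rfl⟩
        rw [← g3]
      · obtain ⟨i, g1, g2, g3⟩ := hE3 t p o tr r h1 ho h2
        have hi : i < F.length := lt_of_lt_of_le g1 (hcN tr (hlt h2).le)
        have h3 := (hE i hi).1
        rw [g2] at h3
        obtain ⟨e1, e2⟩ := h1.unique h3
        refine ⟨_, (memT _).2 (Or.inr ⟨i, hi, mem_seg.2 ⟨hi, rfl⟩⟩), g2, ?_⟩
        simp only
        rw [← e1, ← e2, ← g3]
    obtain ⟨x, hx, e1, e2⟩ := hx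
    obtain ⟨k, hk⟩ := List.mem_iff_get.1 hx
    refine ⟨k.cast hlen.symm, ?_, ?_⟩
    · simp only [Fin.cast_cast, Fin.cast_eq_self, hk, e1]
    · rw [hget]
      simp only [Fin.cast_cast, Fin.cast_eq_self, hk, e2]
  · intro k tr r h
    rw [hget] at h ⊢
    exact (hup _ (hmem k) tr r h).2
  · intro k k' tr r h ht
    rw [hget] at h
    have h1 := (hup _ (hmem k) tr r h).1
    have h2 := hlow _ (hmem k') tr ht
    have h3 := h.1
    simp only at ht h3
    rcases lt_trichotomy k k' with h4 | h4 | h4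
    · exact h4
    · subst h4
      omega
    · have := hlex _ _ h4
      unfold LexR at this
      omega

end Lin

theorem takeWhile_key {k : ℕ} (F : List (Entry k HOp)) (hF : (F.map Entry.key).Nodup) (i : ℕ)
    (hi : i < F.length) (h : List (Entry k HOp)) (hp : h <+: F)
    (hk : F[i].key ∈ h.map Entry.key) :
    i < h.length ∧ (h.takeWhile fun e => decide (e.key ≠ F[i].key)) = F.take i := by
  obtain ⟨e, he, hek⟩ := List.mem_map.1 hk
  obtain ⟨a, ha, rfl⟩ := List.mem_iff_getElem.1 he
  have haF : a < F.length := lt_of_lt_of_le ha hp.length_le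
  have e1 : h[a] = F[a] := hp.getElem ha
  have hinj : ∀ x y (hx : x < F.length) (hy : y < F.length), F[x].key = F[y].key → x = y := by
    intro x y hx hy hxy
    have := (List.nodup_iff_injective_get.1 hF)
      (a₁ := ⟨x, by simpa using hx⟩) (a₂ := ⟨y, by simpa using hy⟩) (by simpa using hxy)
    simpa using this
  have : a = i := hinj a i haF hi (by rw [← e1]; exact hek)
  subst this
  refine ⟨ha, ?_⟩
  have h2 : h = h.take a ++ (h[a] :: h.drop (a + 1)) := by simp
  have h3 : h.take a = F.take a := by
    obtain ⟨tl, rfl⟩ := hp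
    rw [List.take_append_of_le_length ha.le]
  rw [h2, List.takeWhile_append_of_pos, List.takeWhile_cons_of_neg, List.append_nil, h3]
  · simp [e1]
  · intro x hx
    rw [h3] at hx
    obtain ⟨b, hb, rfl⟩ := List.mem_iff_getElem.1 hx
    simp only [List.length_take] at hb
    simp only [List.getElem_take, ne_eq, decide_eq_true_eq]
    intro hc
    have := hinj b a (by omega) haF hc
    omega

namespace ARun

variable {G : Par P HOp HRes} (A : ARun G)

/-- The history decided at time `t`. -/
def cur (t : ℕ) : List (Entry G.k HOp) := Hs (A.s t) (A.D t)

theorem cur_prefix {t t' : ℕ} (h : t ≤ t') (h' : t' ≤ A.len) : A.cur t <+: A.cur t' := by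
  have hE := A.ext t t' h h'
  unfold cur
  rw [← hE.H_eq _ le_rfl]
  exact Hs_mono (A.inv t' h') hE.D_le le_rfl

theorem cnt_inj (q : Fin G.k) {t t' : ℕ} (hi : isInv G q (A.ev t)) (hi' : isInv G q (A.ev t'))
    (h : A.cnt q t = A.cnt q t') : t = t' := by
  rcases lt_trichotomy t t' with h1 | h1 | h1
  · have := A.cnt_lt q h1 hi
    omega
  · exact h1
  · have := A.cnt_lt q h1 hi'
    omega

theorem cnt_ret {t0 tr : ℕ} {p : P} {o : HOp} {q : Fin G.k} (he : A.ev t0 = .inv p o)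
    (ho : G.own p o = some q) (ht0 : t0 < tr) (ht : tr ≤ A.len)
    (hr : ∀ u r, t0 < u → u < tr → A.ev u ≠ .ret p r) : A.cnt q tr = A.cnt q t0 + 1 := by
  obtain ⟨l, h1, h2, _⟩ := A.main_rel p o he tr ht0 ht hr
  obtain ⟨t', h3, h4, h5⟩ := A.pending tr ht p o l h1 q ho
  rcases lt_trichotomy t' t0 with h | h | h
  · have a1 := A.cnt_lt q h ⟨p, o, h4, ho⟩
    have a2 := A.cnt_lt q ht0 ⟨p, o, he, ho⟩
    omega
  · rw [h5, h]
  · exfalso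
    obtain ⟨l', g1, _⟩ := A.main_rel p o he t' h (by omega) (fun u r a b => hr u r a (by omega))
    have hs := A.step t' (by omega)
    rw [h4] at hs
    rw [hs.inv_loc.1] at g1
    cases g1

end ARun

theorem Par.lin (G : Par P HOp HRes) (R : Run G.impl) : IsLin G.spec R := by
  classical
  obtain ⟨A, hlen, hev⟩ := exists_ARun G R
  have hgood := A.good_Hs A.len le_rfl (A.D A.len) le_rfl
  change A.Good A.len (A.cur A.len) at hgood
  set F := A.cur A.len with hF
  have hno : ∀ {t tr p r}, MatchedRet R t tr p r → t < tr ∧ tr < A.len ∧ A.ev tr = .ret p r ∧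
      ∀ u r, t < u → u < tr → A.ev u ≠ .ret p r := by
    intro t tr p r h
    obtain ⟨h1, h2, h3⟩ := h
    rw [hlen, hev]
    refine ⟨h1, h2.1, h2.2, ?_⟩
    intro u r' a b hc
    exact h3 u r' a b ⟨by have := h2.1; omega, hc⟩
  have hex : ∀ i, ∃ t, ∀ hi : i < F.length, t < A.len ∧ A.ev t = .inv (G.pid F[i].q) F[i].op ∧
      G.own (G.pid F[i].q) F[i].op = some F[i].q ∧ A.cnt F[i].q t + 1 = F[i].n := by
    intro i
    by_cases hi : i < F.length
    · obtain ⟨t, h1, h2⟩ := hgood.1 F[i] (List.getElem_mem hi)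
      exact ⟨t, fun _ => ⟨h1, h2⟩⟩
    · exact ⟨0, fun h => absurd h hi⟩
  choose et het using hex
  have hkey : ∀ i i' (hi : i < F.length) (hi' : i' < F.length), F[i].key = F[i'].key → i = i' := by
    intro x y hx hy hxy
    have := (List.nodup_iff_injective_get.1 hgood.2)
      (a₁ := ⟨x, by simpa using hx⟩) (a₂ := ⟨y, by simpa using hy⟩) (by simpa using hxy)
    simpa using this
  have hcl : ∀ t, t ≤ A.len → (A.cur t).length ≤ F.length :=
    fun t ht => (A.cur_prefix ht le_rfl).length_le
  refine lin_core G R F (fun t => (A.cur t).length) et ?_ ?_ ?_ ?_ ?_ ?_ ?_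
  · intro t t' h h'
    exact (A.cur_prefix h (by omega)).length_le
  · intro t ht
    exact hcl t (by omega)
  · intro i hi
    obtain ⟨h1, h2, h3, h4⟩ := het i hi
    exact ⟨⟨by omega, by rw [← hev]; exact h2⟩, by rw [h3]; simp⟩
  · intro i t ht hi
    have hi' := lt_of_lt_of_le hi (hcl t (by omega))
    obtain ⟨h1, h2, h3, h4⟩ := het i hi'
    have e1 : (A.cur t)[i] = F[i] := (A.cur_prefix (by omega) le_rfl).getElem hi
    have hg := (A.good_Hs t (by omega) (A.D t) le_rfl).1 _ (List.getElem_mem hi)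
    rw [e1] at hg
    obtain ⟨t', g1, g2, g3, g4⟩ := hg
    have : et i = t' := A.cnt_inj F[i].q ⟨_, _, h2, h3⟩ ⟨_, _, g2, g3⟩ (by omega)
    omega
  · intro i i' hi hi' h
    obtain ⟨h1, h2, h3, h4⟩ := het i hi
    obtain ⟨h1', h2', h3', h4'⟩ := het i' hi'
    rw [h] at h2 h4
    rw [h2] at h2'
    simp only [Ev.inv.injEq] at h2'
    have hq := G.pid_inj h2'.1
    refine hkey i i' hi hi' ?_
    unfold Entry.key
    rw [hq] at h4
    rw [hq, ← h4, ← h4']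
  · intro t p o tr r h1 h2 h3
    obtain ⟨g1, g2, g3, g4⟩ := hno h3
    have he : A.ev t = .inv p o := by rw [hev]; exact h1.2
    obtain ⟨l, a1, a2, _⟩ := A.main_rel p o he tr g1 g2.le g4
    have hs := A.step tr g2
    rw [g3] at hs
    have hI := A.inv tr g2.le
    generalize A.s (tr + 1) = s' at hs
    cases hs with
    | ret2 _ op h b0 =>
      exfalso
      obtain ⟨c1, _⟩ := hI.loc _ _ _ b0
      rw [a1] at b0
      cases b0
      exact h2 c1
    | ret1 _ op q n h b0 =>
      obtain ⟨c1, c2, c3, j, c4, c5⟩ := hI.loc _ _ _ b0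
      rw [a1] at b0
      cases b0
      have hn : A.cnt q tr = n := by
        rw [A.cnt_eq q tr g2.le, c2, ← G.own_pid _ _ _ c1, a1]
        rfl
      have hn2 := A.cnt_ret he c1 g1 g2.le g4
      have hp1 : h <+: A.cur tr := by rw [c5]; exact Hs_mono hI c4 le_rfl
      have hp2 : h <+: F := hp1.trans (A.cur_prefix g2.le le_rfl)
      have hk : (q, n) ∈ h.map Entry.key := a2
      obtain ⟨e, he', hek⟩ := List.mem_map.1 hk
      obtain ⟨i, hi, rfl⟩ := List.mem_iff_getElem.1 he'
      have hiF : i < F.length := lt_of_lt_of_le hi hp2.length_le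
      have e1 : h[i] = F[i] := hp2.getElem hi
      rw [e1] at hek
      rw [← hek] at hk
      obtain ⟨_, htw⟩ := takeWhile_key F hgood.2 i hiF h hp2 hk
      refine ⟨i, lt_of_lt_of_le hi hp1.length_le, ?_, ?_⟩
      · obtain ⟨k1, k2, k3, k4⟩ := het i hiF
        unfold Entry.key at hek
        simp only [Prod.mk.injEq] at hek
        obtain ⟨q1, q2⟩ := hek
        refine A.cnt_inj q ⟨_, _, k2, by rw [k3, q1]⟩ ⟨_, _, he, c1⟩ ?_
        rw [q1] at k4
        omega
      · rw [← htw, hek]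
  · intro t p o tr r h1 h2 h3
    obtain ⟨g1, g2, g3, g4⟩ := hno h3
    have he : A.ev t = .inv p o := by rw [hev]; exact h1.2
    obtain ⟨l, a1, a2, _⟩ := A.main_rel p o he tr g1 g2.le g4
    have hs := A.step tr g2
    rw [g3] at hs
    have hI := A.inv tr g2.le
    generalize A.s (tr + 1) = s' at hs
    cases hs with
    | ret1 _ op q n h b0 =>
      exfalso
      obtain ⟨c1, _⟩ := hI.loc _ _ _ b0
      rw [a1] at b0
      cases b0
      rw [h2] at c1
      cases c1
    | ret2 _ op h b0 =>
      rw [a1] at b0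
      cases b0
      obtain ⟨j, c1, c2, c3⟩ := a2
      have hp1 : h <+: A.cur tr := by rw [c3]; exact Hs_mono hI c2 le_rfl
      have hp2 : h <+: F := hp1.trans (A.cur_prefix g2.le le_rfl)
      have hE := A.ext t tr g1.le g2.le
      have hp0 : A.cur t <+: h := by
        unfold ARun.cur
        rw [← hE.H_eq _ le_rfl, c3]
        exact Hs_mono hI c1 c2
      refine ⟨h.length, hp0.length_le, hp1.length_le, ?_⟩
      rw [← List.prefix_iff_eq_take.1 hp2]

theorem Par.bound (G : Par P HOp HRes) (R : Run G.impl) : StepBound R (4 * G.k + 12) := by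
  obtain ⟨A, hlen, hev⟩ := exists_ARun G R
  intro t p o h1 b hb hr
  by_cases htb : t < b
  · obtain ⟨l, _, _, h⟩ := A.main_rel p o (by rw [hev]; exact h1.2) b htb (by omega) (by
      intro u r a c hc
      exact hr u r a c ⟨by omega, by rw [← hev]; exact hc⟩)
    rw [hev] at h
    omega
  · have : Finset.Ioo t b = ∅ := by
      ext x
      simp only [Finset.mem_Ioo, Finset.notMem_empty, iff_false]
      omega
    rw [this]
    simp

end Universal

/-- Index of a core process. -/
def arOwn (m n a : ℕ) : ARProc m n a → AOp → Option (Fin (m + n))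
  | _, .audit => none
  | .inl i, _ => some (finSumFinEquiv (.inl i))
  | .inr (.inl i), _ => some (finSumFinEquiv (.inr i))
  | .inr (.inr _), _ => none

/-- The core processes. -/
def arPid (m n a : ℕ) (q : Fin (m + n)) : ARProc m n a :=
  match finSumFinEquiv.symm q with
  | .inl i => .inl i
  | .inr i => .inr (.inl i)

/-- The auditable register as an instance of the universal construction. -/
def arPar (m n a v0 : ℕ) : Par (ARProc m n a) AOp (ARes m) where
  spec := auditSpec m n a v0
  k := m + n
  pid := arPid m n a
  own := arOwn m n a
  own_pid := by
    intro p o q h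
    rcases p with i | i | i <;> cases o <;> simp only [arOwn, Option.some.injEq, reduceCtorEq] at h <;>
      subst h <;> simp only [arPid, Equiv.symm_apply_apply]
  pid_inj := by
    intro x y h
    apply finSumFinEquiv.symm.injective
    unfold arPid at h
    cases hx : finSumFinEquiv.symm x <;> cases hy : finSumFinEquiv.symm y <;>
      simp only [hx, hy] at h <;> simp_all
  own_none := by
    intro p o h s
    rcases p with i | i | i <;> cases o <;> first | rfl | simp [arOwn] at h

/-- Theorem 2.  There is a wait-free linearizable
implementation of an `m`-reader, `n`-writer auditable register (auditable by
any number `a` of auditors) from `(m+n)`-sliding registers and standard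
read/write registers, in which the step complexity of each READ, WRITE and
AUDIT operation is `O(m+n)`. -/
theorem auditable_register_from_sliding_registers :
    ∃ C : ℕ, ∀ (m n a : ℕ), 0 < m → 0 < n → ∀ v0 : ℕ,
      ∃ (Is Ir : Type) (_ : DecidableEq Is) (_ : DecidableEq Ir)
        (Vs : Type) (Vr : Ir → Type) (vr0 : ∀ r : Ir, Vr r)
        (impl : Impl (ARProc m n a) AOp (ARes m) (Is ⊕ Ir)
          (Sum.elim (fun _ : Is => SlidingReg (m + n) Vs)
                    (fun r : Ir => RWReg (Vr r) (vr0 r)))),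
        -- linearizability
        (∀ R : Run impl, LegalRun R (ARLegal m n a) →
            IsLin (auditSpec m n a v0) R) ∧
        (∀ R : Run impl, LegalRun R (ARLegal m n a) →
            StepBound R (C * (m + n))) := by
  refine ⟨10, fun m n a hm hn v0 => ⟨ℕ, Fin (m + n) ⊕ Fin (m + n), inferInstance, inferInstance,
    Fin (m + n) × List (Entry (m + n) AOp), fun _ => Reg (m + n) AOp, fun _ => ⟨0, [], none⟩,
    (arPar m n a v0).impl, ?_, ?_⟩⟩
  · intro R _
    exact Par.lin (arPar m n a v0) R
  · intro R _ t p o h1 b hb hr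
    have h := Par.bound (arPar m n a v0) R t p o h1 b hb hr
    have hk : (arPar m n a v0).k = m + n := rfl
    exact h.trans (by omega)

end Shared
end
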